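/- arXiv:math/0411074 — 2 statements merged into one kernel-verified Lean document; each statement's English description precedes it below -/
import Mathlib

section
/- Let C ⊂ ℝⁿ be a bounded open convex set, P₀ ∈ C, and let (1±ρ)C denote the images of C under the homotheties of center P₀ and ratio 1±ρ. Let Ω be an open set with closure contained in C, and let ε > 0. Then there exists 0 < ρ < 1 such that the closure of Ω is contained in (1−ρ)C and such that for every bounded open convex set Γ with (1−ρ)C ⊂ Γ ⊂ (1+ρ)C one has (1−ε)·λ₁^C(Ω) ≤ λ₁^Γ(Ω) ≤ (1+ε)·λ₁^C(Ω). -/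
open MeasureTheory Set Filter
open scoped ENNReal NNReal

noncomputable section

/-- Euclidean `n`-space. -/
abbrev Euc (n : ℕ) : Type := EuclideanSpace ℝ (Fin n)

/-- The set of parameters `t` such that `p + t • v` lies in `C`. For `C` open bounded
convex, `p ∈ C` and `v ≠ 0` this is an open interval `(t⁻, t⁺)` with `t⁻ < 0 < t⁺`;
the points `p + t⁻ • v` and `p + t⁺ • v` are the two intersections of the boundary `∂C`
with the line through `p` directed by `v`. -/
def lineParams {n : ℕ} (C : Set (Euc n)) (p v : Euc n) : Set ℝ := {t : ℝ | p + t • v ∈ C}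

open Classical in
/-- The Hilbert distance of the convex set `C`: with `a = p + t⁻ • (q - p)` and
`b = p + t⁺ • (q - p)` the two boundary points (so that `a, p, q, b` are in this order),
the cross-ratio `(‖q-a‖ ‖p-b‖)/(‖p-a‖ ‖q-b‖)` equals `((1 - t⁻) t⁺)/((-t⁻)(t⁺ - 1))`. -/
def hDist {n : ℕ} (C : Set (Euc n)) (p q : Euc n) : ℝ :=
  if p = q then 0
  else
    (1 / 2) * Real.log
      (((1 - sInf (lineParams C p (q - p))) * sSup (lineParams C p (q - p))) /
        ((-sInf (lineParams C p (q - p))) * (sSup (lineParams C p (q - p)) - 1)))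

open Classical in
/-- The Hilbert Finsler norm of `u` at `p`: with `p⁺ = p + t⁺ • u`, `p⁻ = p + t⁻ • u`
the two boundary points on the line through `p` directed by `u`, one has
`(1/2)‖u‖(1/‖p-p⁺‖ + 1/‖p-p⁻‖) = (1/2)(1/t⁺ - 1/t⁻)`. -/
def fNorm {n : ℕ} (C : Set (Euc n)) (p u : Euc n) : ℝ :=
  if u = 0 then 0
  else (1 / 2) * (1 / sSup (lineParams C p u) - 1 / sInf (lineParams C p u))

/-- The dual norm of a linear form `l` at `p`: `sup {l u : ‖u‖_{C,p} = 1}`. -/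
def dualNorm {n : ℕ} (C : Set (Euc n)) (p : Euc n) (l : Euc n →L[ℝ] ℝ) : ℝ :=
  sSup ((fun u => l u) '' {u : Euc n | fNorm C p u = 1})

/-- The tangent ball `TB_R(p) = {u : ‖u‖_{C,p} < R}`. -/
def tangentBall {n : ℕ} (C : Set (Euc n)) (p : Euc n) (R : ℝ) : Set (Euc n) :=
  {u : Euc n | fNorm C p u < R}

/-- `ωₙ`, the Lebesgue volume of the Euclidean unit ball of `ℝⁿ`. -/
def omegaVol (n : ℕ) : ℝ := (volume (Metric.ball (0 : Euc n) 1)).toReal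

/-- The Hilbert (Busemann) measure of `C`: density `ωₙ / vol_e(TB_C(p))` against
Lebesgue measure, supported on `C`. -/
def hMeasure {n : ℕ} (C : Set (Euc n)) : Measure (Euc n) :=
  (volume.restrict C).withDensity fun p =>
    ENNReal.ofReal (omegaVol n / (volume (tangentBall C p 1)).toReal)

/-- Admissible test functions: nonzero Lipschitz functions with compact support
contained in `Ω`. -/
def testFuns {n : ℕ} (Ω : Set (Euc n)) : Set (Euc n → ℝ) :=
  {f : Euc n → ℝ |
    (∃ K : ℝ≥0, LipschitzWith K f) ∧ f ≠ 0 ∧ HasCompactSupport f ∧ tsupport f ⊆ Ω}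

/-- The Rayleigh quotient of `f` on `Ω`, with respect to the Hilbert geometry of `C`
(`df` is the a.e.-defined differential of the Lipschitz function `f`). -/
def rayleigh {n : ℕ} (C Ω : Set (Euc n)) (f : Euc n → ℝ) : ℝ :=
  (∫ p in Ω, dualNorm C p (fderiv ℝ f p) ^ 2 ∂hMeasure C) /
    ∫ p in Ω, f p ^ 2 ∂hMeasure C

/-- The Dirichlet bottom of the spectrum `λ₁^C(Ω)`. -/
def lambda1D {n : ℕ} (C Ω : Set (Euc n)) : ℝ := sInf (rayleigh C Ω '' testFuns Ω)

/-- The bottom of the spectrum `λ₁(C)` of the Hilbert geometry of `C`. -/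
def lambda1 {n : ℕ} (C : Set (Euc n)) : ℝ := lambda1D C C

/-- The Gromov product `(x|y)_t = (d(x,t) + d(y,t) - d(x,y))/2`. -/
def gromovProd {n : ℕ} (d : Euc n → Euc n → ℝ) (x y t : Euc n) : ℝ :=
  (d x t + d y t - d x y) / 2

/-- `(C, d_C)` is `δ`-hyperbolic: for all `x y z t` in `C`,
`(x|y)_t ≥ min((x|z)_t, (y|z)_t) - δ`. -/
def IsDeltaHyp {n : ℕ} (C : Set (Euc n)) (δ : ℝ) : Prop :=
  ∀ x ∈ C, ∀ y ∈ C, ∀ z ∈ C, ∀ t ∈ C,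
    gromovProd (hDist C) x y t ≥
      min (gromovProd (hDist C) x z t) (gromovProd (hDist C) y z t) - δ

/-- The metric ball `B_R(x)` of the Hilbert metric of `C`. -/
def hBall {n : ℕ} (C : Set (Euc n)) (x : Euc n) (R : ℝ) : Set (Euc n) :=
  {y ∈ C | hDist C x y < R}

/-- The image of `C` under the homothety of center `P₀` and ratio `r`. -/
def homoth {n : ℕ} (P₀ : Euc n) (r : ℝ) (C : Set (Euc n)) : Set (Euc n) :=
  (fun x => P₀ + r • (x - P₀)) '' C

/-- Diameter of a set with respect to a distance function `d`. -/
def ediamD {α : Type*} (d : α → α → ℝ) (S : Set α) : ℝ≥0∞ :=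
  ⨆ x ∈ S, ⨆ y ∈ S, ENNReal.ofReal (d x y)

/-- The `k`-dimensional Hausdorff measure of `S` with respect to the distance
function `d`. -/
def hausD {α : Type*} (k : ℝ) (d : α → α → ℝ) (S : Set α) : ℝ≥0∞ :=
  ⨆ (ε : ℝ≥0∞) (_ : 0 < ε),
    ⨅ (U : ℕ → Set α) (_ : S ⊆ ⋃ i, U i) (_ : ∀ i, ediamD d (U i) ≤ ε),
      ∑' i, ediamD d (U i) ^ k

/-- The frontier of `U` is a rectifiable closed curve (for the Hilbert metric of `C`):
it is the image of a closed continuous curve and has finite one-dimensional Hausdorff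
measure. -/
def RectCurveBoundary (C U : Set (Euc 2)) : Prop :=
  ∃ c : ℝ → Euc 2, ContinuousOn c (Icc 0 1) ∧ c '' Icc (0 : ℝ) 1 = frontier U ∧
    c 0 = c 1 ∧ hausD 1 (hDist C) (frontier U) < ⊤

/-- The Cheeger constant `I_∞^C(Ω)` in dimension `2`: infimum of
`ν_C(∂U)/μ_C(U)` over open sets `U` with closure contained in `Ω` whose boundary is a
rectifiable curve, `ν_C` being the `1`-dimensional Hausdorff measure of `(C, d_C)`. -/
def cheeger2D (C Ω : Set (Euc 2)) : ℝ :=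
  sInf {r : ℝ | ∃ U : Set (Euc 2), IsOpen U ∧ U.Nonempty ∧ closure U ⊆ Ω ∧
    RectCurveBoundary C U ∧
    r = (hausD 1 (hDist C) (frontier U)).toReal / (hMeasure C U).toReal}

/-- The Cheeger constant `I_∞(C)` of a planar Hilbert geometry. -/
def cheeger2 (C : Set (Euc 2)) : ℝ := cheeger2D C C

/-- `S` is a `C¹` hypersurface: near each of its points it is the zero set of a `C¹`
function with nonvanishing differential. -/
def IsC1Hypersurface {n : ℕ} (S : Set (Euc n)) : Prop :=
  ∀ x ∈ S, ∃ (f : Euc n → ℝ) (U : Set (Euc n)), U ∈ nhds x ∧ ContDiffOn ℝ 1 f U ∧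
    (∀ y ∈ U, fderiv ℝ f y ≠ 0) ∧ S ∩ U = {y ∈ U | f y = 0}

/-- The Cheeger constant `I_∞^C(Ω)` in dimension `n`: infimum of `ν_C(∂U)/μ_C(U)` over
open sets `U` with closure contained in `Ω` whose boundary is a `C¹` hypersurface,
`ν_C` being the `(n-1)`-dimensional Hausdorff measure of `(C, d_C)`. -/
def cheegerND {n : ℕ} (C Ω : Set (Euc n)) : ℝ :=
  sInf {r : ℝ | ∃ U : Set (Euc n), IsOpen U ∧ U.Nonempty ∧ closure U ⊆ Ω ∧
    IsC1Hypersurface (frontier U) ∧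
    r = (hausD ((n : ℝ) - 1) (hDist C) (frontier U)).toReal / (hMeasure C U).toReal}

/-- The boundary of the convex set `C` is of class `C¹`: through each boundary point
passes a unique supporting hyperplane. -/
def HasC1Boundary {n : ℕ} (C : Set (Euc n)) : Prop :=
  ∀ x ∈ frontier C, ∃! l : Euc n →L[ℝ] ℝ, ‖l‖ = 1 ∧ ∀ y ∈ C, l y ≤ l x

/-- The convex set `C` is strictly convex: the open segment joining two distinct
boundary points is contained in `C`. -/
def IsStrictlyConvexSet {n : ℕ} (C : Set (Euc n)) : Prop :=
  ∀ x ∈ frontier C, ∀ y ∈ frontier C, x ≠ y → openSegment ℝ x y ⊆ C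

end


/-- Pointed open bounded convex set. -/
structure HGood {n : ℕ} (C : Set (Euc n)) (p : Euc n) : Prop where
  conv : Convex ℝ C
  opn : IsOpen C
  bdd : Bornology.IsBounded C
  mem : p ∈ C

/-- One-sided comparison of pointed sets. -/
def HilSub {n : ℕ} (a : ℝ) (C : Set (Euc n)) (p : Euc n) (D : Set (Euc n)) (q : Euc n) : Prop :=
  ∀ v : Euc n, p + v ∈ C → q + a⁻¹ • v ∈ D

lemma HGood.bound {n : ℕ} {C : Set (Euc n)} {p : Euc n} (h : HGood C p) :
    ∃ R : ℝ, 0 < R ∧ ∀ u : Euc n, ∀ t ∈ lineParams C p u, |t| * ‖u‖ ≤ R := by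
  obtain ⟨R, hR⟩ := h.bdd.subset_closedBall p
  refine ⟨max R 1, by positivity, fun u t ht => ?_⟩
  have := hR ht
  rw [Metric.mem_closedBall, dist_eq_norm, add_sub_cancel_left, norm_smul, Real.norm_eq_abs] at this
  exact this.trans (le_max_left _ _)

lemma HGood.line {n : ℕ} {C : Set (Euc n)} {p : Euc n} (h : HGood C p) {u : Euc n} (hu : u ≠ 0) :
    BddAbove (lineParams C p u) ∧ BddBelow (lineParams C p u) ∧
      0 < sSup (lineParams C p u) ∧ sInf (lineParams C p u) < 0 ∧ (0:ℝ) ∈ lineParams C p u := by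
  obtain ⟨R, hR, hb⟩ := h.bound
  have hu' : 0 < ‖u‖ := norm_pos_iff.2 hu
  have hA : BddAbove (lineParams C p u) :=
    ⟨R / ‖u‖, fun t ht => (le_abs_self t).trans ((le_div_iff₀ hu').2 (hb u t ht))⟩
  have hB : BddBelow (lineParams C p u) :=
    ⟨-(R / ‖u‖), fun t ht => neg_le_of_abs_le ((le_div_iff₀ hu').2 (hb u t ht))⟩
  have h0 : (0:ℝ) ∈ lineParams C p u := by simpa [lineParams] using h.mem
  have hO : IsOpen (lineParams C p u) :=
    h.opn.preimage (f := fun t : ℝ => p + t • u) (by fun_prop)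
  obtain ⟨r, hr, hball⟩ := Metric.isOpen_iff.1 hO 0 h0
  have h1 : r / 2 ∈ lineParams C p u := hball (by
    simp [abs_of_pos hr]; exact hr)
  have h2 : -(r / 2) ∈ lineParams C p u := hball (by
    simp [abs_of_pos hr]; exact hr)
  refine ⟨hA, hB, ?_, ?_, h0⟩
  · exact lt_of_lt_of_le (by positivity) (le_csSup hA h1)
  · exact lt_of_le_of_lt (csInf_le hB h2) (by linarith)

lemma fNorm_zero {n : ℕ} (C : Set (Euc n)) (p : Euc n) : fNorm C p 0 = 0 := by simp [fNorm]

lemma HGood.fNorm_nonneg {n : ℕ} {C : Set (Euc n)} {p : Euc n} (h : HGood C p) (u : Euc n) :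
    0 ≤ fNorm C p u := by
  by_cases hu : u = 0
  · simp [hu, fNorm_zero]
  obtain ⟨-, -, h1, h2, -⟩ := h.line hu
  rw [fNorm, if_neg hu]
  have : 0 < 1 / sSup (lineParams C p u) := by positivity
  have : 1 / sInf (lineParams C p u) < 0 := one_div_neg.2 h2
  linarith

lemma HilSub.fNorm_le {n : ℕ} {C D : Set (Euc n)} {p q : Euc n} {a : ℝ} (ha : 0 < a)
    (hC : HGood C p) (hD : HGood D q) (h : HilSub a C p D q) (u : Euc n) :
    fNorm D q u ≤ a * fNorm C p u := by
  by_cases hu : u = 0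
  · simp [hu, fNorm_zero]
  obtain ⟨c1, c2, c3, c4, c5⟩ := hC.line hu
  obtain ⟨d1, d2, d3, d4, d5⟩ := hD.line hu
  have key : ∀ t ∈ lineParams C p u, a⁻¹ * t ∈ lineParams D q u := fun t ht => by
    have := h (t • u) ht
    rwa [smul_smul] at this
  have e1 : sSup (lineParams C p u) ≤ a * sSup (lineParams D q u) := by
    refine csSup_le ⟨0, c5⟩ fun t ht => ?_
    have := le_csSup d1 (key t ht)
    rwa [inv_mul_le_iff₀ ha] at this
  have e2 : a * sInf (lineParams D q u) ≤ sInf (lineParams C p u) := by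
    refine le_csInf ⟨0, c5⟩ fun t ht => ?_
    have := csInf_le d2 (key t ht)
    rwa [le_inv_mul_iff₀ ha] at this
  rw [fNorm, fNorm, if_neg hu, if_neg hu]
  generalize sSup (lineParams C p u) = S at *
  generalize sSup (lineParams D q u) = S' at *
  generalize sInf (lineParams C p u) = I at *
  generalize sInf (lineParams D q u) = I' at *
  have f1 : 1 / S' ≤ a * (1 / S) := by
    rw [mul_one_div, div_le_div_iff₀ d3 c3]; linarith
  have f2 : 1 / (-I') ≤ a * (1 / (-I)) := by
    rw [mul_one_div, div_le_div_iff₀ (by linarith) (by linarith)]; linarith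
  rw [one_div_neg_eq_neg_one_div, one_div_neg_eq_neg_one_div] at f2
  linarith

open scoped Pointwise in
lemma fNorm_smul {n : ℕ} (C : Set (Euc n)) (p u : Euc n) {c : ℝ} (hc : 0 < c) :
    fNorm C p (c • u) = c * fNorm C p u := by
  by_cases hu : u = 0
  · simp [hu, fNorm_zero]
  have hcu : c • u ≠ 0 := smul_ne_zero hc.ne' hu
  have : lineParams C p (c • u) = c⁻¹ • lineParams C p u := by
    ext t
    rw [Set.mem_inv_smul_set_iff₀ hc.ne']
    simp [lineParams, smul_smul, mul_comm]
  rw [fNorm, fNorm, if_neg hu, if_neg hcu, this, Real.sSup_smul_of_nonneg (by positivity),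
    Real.sInf_smul_of_nonneg (by positivity)]
  simp only [smul_eq_mul, one_div, mul_inv, inv_inv]
  ring

open scoped Pointwise in
lemma fNorm_neg {n : ℕ} (C : Set (Euc n)) (p u : Euc n) :
    fNorm C p (-u) = fNorm C p u := by
  by_cases hu : u = 0
  · simp [hu]
  have : lineParams C p (-u) = - lineParams C p u := by
    ext t
    simp [lineParams]
  rw [fNorm, fNorm, if_neg hu, if_neg (neg_ne_zero.2 hu), this, Real.sSup_neg, Real.sInf_neg]
  simp only [one_div, inv_neg]
  ring

lemma HGood.norm_le {n : ℕ} {C : Set (Euc n)} {p : Euc n} (h : HGood C p) :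
    ∃ R : ℝ, 0 < R ∧ ∀ u : Euc n, fNorm C p u = 1 → ‖u‖ ≤ R := by
  obtain ⟨R, hR, hb⟩ := h.bound
  refine ⟨R, hR, fun u hu1 => ?_⟩
  by_cases hu : u = 0
  · simp [hu, hR.le]
  obtain ⟨c1, c2, c3, c4, c5⟩ := h.line hu
  have hu' : 0 < ‖u‖ := norm_pos_iff.2 hu
  have e1 : sSup (lineParams C p u) ≤ R / ‖u‖ :=
    csSup_le ⟨0, c5⟩ fun t ht => (le_abs_self t).trans ((le_div_iff₀ hu').2 (hb u t ht))
  have e2 : -(R / ‖u‖) ≤ sInf (lineParams C p u) :=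
    le_csInf ⟨0, c5⟩ fun t ht => neg_le_of_abs_le ((le_div_iff₀ hu').2 (hb u t ht))
  rw [fNorm, if_neg hu] at hu1
  generalize sSup (lineParams C p u) = S at *
  generalize sInf (lineParams C p u) = I at *
  have f1 : ‖u‖ / R ≤ 1 / S := by
    rw [← one_div_div]; exact one_div_le_one_div_of_le c3 e1
  have f2 : ‖u‖ / R ≤ 1 / (-I) := by
    rw [← one_div_div]; exact one_div_le_one_div_of_le (by linarith) (by linarith)
  rw [one_div_neg_eq_neg_one_div] at f2
  have : ‖u‖ / R ≤ 1 := by linarith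
  rwa [div_le_one hR] at this

lemma HGood.bddAbove {n : ℕ} {C : Set (Euc n)} {p : Euc n} (h : HGood C p)
    (l : Euc n →L[ℝ] ℝ) : BddAbove ((fun u => l u) '' {u : Euc n | fNorm C p u = 1}) := by
  obtain ⟨R, hR, hb⟩ := h.norm_le
  refine ⟨‖l‖ * R, ?_⟩
  rintro _ ⟨u, hu, rfl⟩
  calc l u ≤ ‖l u‖ := le_abs_self _
    _ ≤ ‖l‖ * ‖u‖ := l.le_opNorm u
    _ ≤ ‖l‖ * R := by gcongr; exact hb u hu

lemma HGood.le_dual {n : ℕ} {C : Set (Euc n)} {p : Euc n} (h : HGood C p)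
    (l : Euc n →L[ℝ] ℝ) {u : Euc n} (hu : fNorm C p u = 1) : l u ≤ dualNorm C p l :=
  le_csSup (h.bddAbove l) ⟨u, hu, rfl⟩

lemma HGood.dual_nonneg {n : ℕ} {C : Set (Euc n)} {p : Euc n} (h : HGood C p)
    (l : Euc n →L[ℝ] ℝ) : 0 ≤ dualNorm C p l := by
  by_cases hS : ∃ u : Euc n, fNorm C p u = 1
  · obtain ⟨u, hu⟩ := hS
    have h1 := h.le_dual l hu
    have h2 := h.le_dual l (u := -u) (by rw [fNorm_neg, hu])
    rw [map_neg] at h2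
    linarith
  · have : {u : Euc n | fNorm C p u = 1} = ∅ := by
      ext u; simp; exact fun hu => hS ⟨u, hu⟩
    simp [dualNorm, this]

lemma HGood.dual_lip {n : ℕ} {C : Set (Euc n)} {p : Euc n} (h : HGood C p) :
    Continuous (fun l => dualNorm C p l) := by
  obtain ⟨R, hR, hb⟩ := h.norm_le
  have key : ∀ l l' : Euc n →L[ℝ] ℝ, dualNorm C p l ≤ dualNorm C p l' + R * dist l l' := by
    intro l l'
    refine Real.sSup_le ?_ (add_nonneg (h.dual_nonneg l') (by positivity))
    rintro _ ⟨u, hu, rfl⟩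
    have h1 := h.le_dual l' hu
    have h2 : l u - l' u ≤ R * dist l l' := by
      calc l u - l' u = (l - l') u := by simp
        _ ≤ ‖(l - l') u‖ := le_abs_self _
        _ ≤ ‖l - l'‖ * ‖u‖ := (l - l').le_opNorm u
        _ ≤ ‖l - l'‖ * R := by gcongr; exact hb u hu
        _ = R * dist l l' := by rw [dist_eq_norm, mul_comm]
    simp only
    linarith
  exact (LipschitzWith.of_le_add_mul ⟨R, hR.le⟩ key).continuous

lemma HilSub.dual_le {n : ℕ} {C D : Set (Euc n)} {p q : Euc n} {a : ℝ} (ha : 0 < a)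
    (hC : HGood C p) (hD : HGood D q) (h : HilSub a C p D q) (h' : HilSub a D q C p)
    (l : Euc n →L[ℝ] ℝ) :
    dualNorm D q l ≤ a * dualNorm C p l := by
  refine Real.sSup_le ?_ (mul_nonneg ha.le (hC.dual_nonneg l))
  rintro _ ⟨u, hu, rfl⟩
  have hu : fNorm D q u = 1 := hu
  have h1 := h.fNorm_le ha hC hD u
  have h2 := h'.fNorm_le ha hD hC u
  rw [hu] at h1 h2
  set s := fNorm C p u with hs
  have hs0 : 0 < s := by
    rcases (hC.fNorm_nonneg u).eq_or_lt with h0 | h0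
    · rw [← hs] at h0; rw [← h0] at h1; norm_num at h1
    · exact h0
  have h3 := hC.le_dual l (u := s⁻¹ • u) (by
    rw [fNorm_smul _ _ _ (by positivity), ← hs, inv_mul_cancel₀ hs0.ne'])
  rw [map_smul, smul_eq_mul, inv_mul_le_iff₀ hs0] at h3
  refine h3.trans ?_
  gcongr
  · exact hC.dual_nonneg l
  · linarith

open scoped Pointwise in
lemma HilSub.vol_le {n : ℕ} {C D : Set (Euc n)} {p q : Euc n} {a : ℝ} (ha : 0 < a)
    (hC : HGood C p) (hD : HGood D q) (h' : HilSub a D q C p) :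
    volume (tangentBall D q 1) ≤ ENNReal.ofReal (a ^ n) * volume (tangentBall C p 1) := by
  have : tangentBall D q 1 ⊆ a • tangentBall C p 1 := by
    intro u hu
    have hu : fNorm D q u < 1 := hu
    rw [Set.mem_smul_set_iff_inv_smul_mem₀ ha.ne']
    show fNorm C p _ < 1
    rw [fNorm_smul _ _ _ (by positivity), inv_mul_lt_iff₀ ha]
    refine (h'.fNorm_le ha hD hC u).trans_lt ?_
    gcongr
  refine (measure_mono this).trans ?_
  rw [Measure.addHaar_smul_of_nonneg _ ha.le]
  simp

lemma toReal_le_of_two {x y : ℝ≥0∞} {k : ℝ} (hk : 0 ≤ k) (h : x ≤ ENNReal.ofReal k * y)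
    (h' : y ≤ ENNReal.ofReal k * x) : x.toReal ≤ k * y.toReal := by
  by_cases hy : y = ⊤
  · have : x = ⊤ := by
      by_contra hx
      rw [hy] at h'
      exact absurd h' (not_le.2 (ENNReal.mul_lt_top ENNReal.ofReal_lt_top (lt_top_iff_ne_top.2 hx)))
    simp [this, hy]
  · have := ENNReal.toReal_mono (ENNReal.mul_ne_top ENNReal.ofReal_ne_top hy) h
    rwa [ENNReal.toReal_mul, ENNReal.toReal_ofReal hk] at this

lemma div_le_of_two {v w k : ℝ} (hv : 0 ≤ v) (hw : 0 ≤ w) (hk : 0 ≤ k) (h : v ≤ k * w)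
    (h' : w ≤ k * v) {N M m : ℝ} (hN : 0 ≤ N) (hNM : N ≤ m * M) :
    N / v ≤ m * k * (M / w) := by
  rcases hv.eq_or_lt with h0 | h0
  · have : w = 0 := by rw [← h0] at h'; linarith
    simp [← h0, this]
  · have hw0 : 0 < w := by
      rcases hw.eq_or_lt with h1 | h1
      · rw [← h1] at h; linarith
      · exact h1
    rw [← mul_div_assoc, div_le_div_iff₀ h0 hw0]
    calc N * w ≤ N * (k * v) := by gcongr
      _ ≤ (m * M) * (k * v) := by gcongr
      _ = _ := by ring

/-- Density of the Hilbert measure. -/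
noncomputable def hDens {n : ℕ} (C : Set (Euc n)) (p : Euc n) : ℝ≥0∞ :=
  ENNReal.ofReal (omegaVol n / (volume (tangentBall C p 1)).toReal)

lemma HilSub.dens_le {n : ℕ} {C D : Set (Euc n)} {p q : Euc n} {a : ℝ} (ha : 0 < a)
    (hC : HGood C p) (hD : HGood D q) (h : HilSub a C p D q) (h' : HilSub a D q C p) :
    hDens D q ≤ ENNReal.ofReal (a ^ n) * hDens C p := by
  have h1 := h'.vol_le ha hC hD
  have h2 := h.vol_le ha hD hC
  have hk : 0 ≤ a ^ n := by positivity
  rw [hDens, hDens, ← ENNReal.ofReal_mul hk]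
  refine ENNReal.ofReal_le_ofReal ?_
  have := div_le_of_two (N := omegaVol n) (M := omegaVol n) (m := 1) ENNReal.toReal_nonneg
    ENNReal.toReal_nonneg hk (toReal_le_of_two hk h1 h2) (toReal_le_of_two hk h2 h1)
    ENNReal.toReal_nonneg (by simp)
  simpa using this

lemma hMeasure_restrict {n : ℕ} {C Ω : Set (Euc n)} (hΩ : IsOpen Ω) (hsub : Ω ⊆ C) :
    (hMeasure C).restrict Ω = (volume.restrict Ω).withDensity (hDens C) := by
  rw [hMeasure, restrict_withDensity hΩ.measurableSet,
    Measure.restrict_restrict hΩ.measurableSet, inter_eq_self_of_subset_left hsub]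
  rfl

lemma hMeasure_le {n : ℕ} {C D Ω : Set (Euc n)} (hΩ : IsOpen Ω) (hC : Ω ⊆ C) (hD : Ω ⊆ D)
    {k : ℝ} (h : ∀ p ∈ Ω, hDens D p ≤ ENNReal.ofReal k * hDens C p) :
    (hMeasure D).restrict Ω ≤ ENNReal.ofReal k • (hMeasure C).restrict Ω := by
  rw [hMeasure_restrict hΩ hC, hMeasure_restrict hΩ hD,
    ← withDensity_smul' _ _ ENNReal.ofReal_ne_top]
  exact withDensity_mono ((ae_restrict_iff' hΩ.measurableSet).2 (ae_of_all _ h))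

lemma lint_le {n : ℕ} {C D Ω : Set (Euc n)} (hΩ : IsOpen Ω) (hC : Ω ⊆ C) (hD : Ω ⊆ D)
    {k m : ℝ} (hk : 0 ≤ k) (hm : 0 ≤ m)
    (h : ∀ p ∈ Ω, hDens D p ≤ ENNReal.ofReal k * hDens C p)
    {F G : Euc n → ℝ} (hFG : ∀ p ∈ Ω, F p ≤ m * G p) :
    ∫⁻ p in Ω, ENNReal.ofReal (F p) ∂hMeasure D ≤
      ENNReal.ofReal (m * k) * ∫⁻ p in Ω, ENNReal.ofReal (G p) ∂hMeasure C := by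
  calc ∫⁻ p in Ω, ENNReal.ofReal (F p) ∂hMeasure D
      ≤ ∫⁻ p in Ω, ENNReal.ofReal m * ENNReal.ofReal (G p) ∂hMeasure D := by
        refine setLIntegral_mono' hΩ.measurableSet fun p hp => ?_
        rw [← ENNReal.ofReal_mul hm]
        exact ENNReal.ofReal_le_ofReal (hFG p hp)
    _ = ENNReal.ofReal m * ∫⁻ p in Ω, ENNReal.ofReal (G p) ∂hMeasure D :=
        lintegral_const_mul' _ _ ENNReal.ofReal_ne_top
    _ ≤ ENNReal.ofReal m * (ENNReal.ofReal k * ∫⁻ p in Ω, ENNReal.ofReal (G p) ∂hMeasure C) := by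
        gcongr
        rw [← smul_eq_mul, ← lintegral_smul_measure]
        exact lintegral_mono' (hMeasure_le hΩ hC hD h) le_rfl
    _ = _ := by rw [ENNReal.ofReal_mul hm, mul_assoc]

lemma int_le {n : ℕ} {C D Ω : Set (Euc n)} (hΩ : IsOpen Ω) (hC : Ω ⊆ C) (hD : Ω ⊆ D)
    {k m : ℝ} (hk : 0 ≤ k) (hm : 0 ≤ m)
    (h : ∀ p ∈ Ω, hDens D p ≤ ENNReal.ofReal k * hDens C p)
    (h' : ∀ p ∈ Ω, hDens C p ≤ ENNReal.ofReal k * hDens D p)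
    {F G : Euc n → ℝ} (hFG : ∀ p ∈ Ω, F p ≤ m * G p) (hGF : ∀ p ∈ Ω, G p ≤ m * F p)
    (hF0 : ∀ p, 0 ≤ F p) (hG0 : ∀ p, 0 ≤ G p)
    (hF : AEStronglyMeasurable F (volume.restrict Ω))
    (hG : AEStronglyMeasurable G (volume.restrict Ω)) :
    ∫ p in Ω, F p ∂hMeasure D ≤ m * k * ∫ p in Ω, G p ∂hMeasure C := by
  rw [integral_eq_lintegral_of_nonneg_ae (ae_of_all _ hF0) (by
      rw [hMeasure_restrict hΩ hD]; exact hF.mono_ac (withDensity_absolutelyContinuous _ _)),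
    integral_eq_lintegral_of_nonneg_ae (ae_of_all _ hG0) (by
      rw [hMeasure_restrict hΩ hC]; exact hG.mono_ac (withDensity_absolutelyContinuous _ _))]
  exact toReal_le_of_two (by positivity) (lint_le hΩ hC hD hk hm h hFG)
    (lint_le hΩ hD hC hk hm h' hGF)

lemma HGood.near {n : ℕ} {C : Set (Euc n)} {p : Euc n} (h : HGood C p) {a : ℝ} (ha : 1 < a) :
    ∀ᶠ q in nhds p, HilSub a C p C q ∧ HilSub a C q C p := by
  obtain ⟨r, hr, hball⟩ := Metric.isOpen_iff.1 h.opn p h.mem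
  have ha' : a⁻¹ < 1 := inv_lt_one_of_one_lt₀ ha
  have ha0 : 0 < a⁻¹ := by positivity
  have hb : 0 < 1 - a⁻¹ := by linarith
  filter_upwards [Metric.ball_mem_nhds p (mul_pos hr hb)] with q hq
  rw [Metric.mem_ball, dist_eq_norm] at hq
  have key : ∀ w : Euc n, ‖w‖ < r * (1 - a⁻¹) → p + (1 - a⁻¹)⁻¹ • w ∈ C := by
    intro w hw
    apply hball
    rw [Metric.mem_ball, dist_eq_norm, add_sub_cancel_left, norm_smul, norm_inv,
      Real.norm_of_nonneg hb.le, inv_mul_lt_iff₀ hb]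
    linarith
  constructor
  · intro v hv
    have := h.conv hv (key _ hq) ha0.le hb.le (by ring)
    rw [smul_add (1 - a⁻¹), smul_inv_smul₀ hb.ne'] at this
    convert this using 1
    module
  · intro v hv
    have := h.conv hv (key (-(a⁻¹ • (q - p))) (by
      rw [norm_neg, norm_smul, Real.norm_of_nonneg ha0.le]
      nlinarith [norm_nonneg (q - p)])) ha0.le hb.le (by ring)
    rw [smul_add (1 - a⁻¹), smul_inv_smul₀ hb.ne'] at this
    convert this using 1
    module

lemma dual_continuousOn {n : ℕ} {C : Set (Euc n)} (hconv : Convex ℝ C) (hopen : IsOpen C)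
    (hbdd : Bornology.IsBounded C) (l : Euc n →L[ℝ] ℝ) :
    ContinuousOn (fun p => dualNorm C p l) C := by
  intro p hp
  refine ContinuousAt.continuousWithinAt ?_
  have hg : HGood C p := ⟨hconv, hopen, hbdd, hp⟩
  rw [Metric.continuousAt_iff']
  intro e he
  set d := dualNorm C p l with hd
  have hd0 : 0 ≤ d := hg.dual_nonneg l
  set a := 1 + e / (2 * (d + e)) with haa
  have hpos : 0 < e / (2 * (d + e)) := by positivity
  have h1a : 1 < a := by linarith
  have ha0 : 0 < a := by linarith
  have hsmall : (a - 1) * d < e / 2 := by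
    rw [haa, add_sub_cancel_left, div_mul_eq_mul_div, div_lt_div_iff₀ (by positivity) (by norm_num)]
    nlinarith
  have hle : a - 1 ≤ 1 / 2 := by
    rw [haa, add_sub_cancel_left, div_le_div_iff₀ (by positivity) (by norm_num)]
    linarith
  filter_upwards [hg.near h1a, hopen.mem_nhds hp] with q hq hqC
  have hgq : HGood C q := ⟨hconv, hopen, hbdd, hqC⟩
  have h1 := hq.1.dual_le ha0 hg hgq hq.2 l
  have h2 := hq.2.dual_le ha0 hgq hg hq.1 l
  rw [← hd] at h1 h2
  set d' := dualNorm C q l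
  rw [Real.dist_eq, abs_lt]
  constructor <;> nlinarith

open Classical in
lemma dual_meas {n : ℕ} {C Ω : Set (Euc n)} (hconv : Convex ℝ C) (hopen : IsOpen C)
    (hbdd : Bornology.IsBounded C) (hΩ : IsOpen Ω) (hsub : Ω ⊆ C) (f : Euc n → ℝ) :
    AEStronglyMeasurable (fun p => dualNorm C p (fderiv ℝ f p) ^ 2) (volume.restrict Ω) := by
  have hm : Measurable (Function.uncurry
      fun (l : Euc n →L[ℝ] ℝ) (p : Euc n) => C.indicator (fun q => dualNorm C q l) p) := by
    apply measurable_uncurry_of_continuous_of_measurable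
    · intro p
      by_cases hp : p ∈ C
      · simpa [hp] using HGood.dual_lip ⟨hconv, hopen, hbdd, hp⟩
      · simp [hp, continuous_const]
    · intro l
      have := (dual_continuousOn hconv hopen hbdd l).measurable_piecewise
        (g := fun _ => (0:ℝ)) continuousOn_const hopen.measurableSet
      rw [← Set.piecewise_eq_indicator]
      exact this
  have h2 : Measurable (fun p => C.indicator (fun q => dualNorm C q (fderiv ℝ f p)) p ^ 2) :=
    (hm.comp ((measurable_fderiv ℝ f).prodMk measurable_id)).pow_const 2
  refine h2.aestronglyMeasurable.congr ((ae_restrict_iff' hΩ.measurableSet).2 (ae_of_all _ ?_))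
  intro p hp
  simp [hsub hp]

lemma rayleigh_nonneg {n : ℕ} (C Ω : Set (Euc n)) (f : Euc n → ℝ) : 0 ≤ rayleigh C Ω f :=
  div_nonneg (integral_nonneg fun _ => sq_nonneg _) (integral_nonneg fun _ => sq_nonneg _)

lemma rayleigh_le {n : ℕ} {C D Ω : Set (Euc n)} {a : ℝ} (ha : 0 < a) (hΩ : IsOpen Ω)
    (hC : ∀ p ∈ Ω, HGood C p) (hD : ∀ p ∈ Ω, HGood D p)
    (h : ∀ p ∈ Ω, HilSub a C p D p) (h' : ∀ p ∈ Ω, HilSub a D p C p) {f : Euc n → ℝ}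
    (hf : Continuous f) :
    rayleigh D Ω f ≤ a ^ (2 + n + n) * rayleigh C Ω f := by
  rcases Ω.eq_empty_or_nonempty with he | ⟨p₀, hp₀⟩
  · simp [rayleigh, he]
  have sC : Ω ⊆ C := fun p hp => (hC p hp).mem
  have sD : Ω ⊆ D := fun p hp => (hD p hp).mem
  have hk : 0 ≤ a ^ n := by positivity
  have e1 := fun p hp => (h p hp).dens_le ha (hC p hp) (hD p hp) (h' p hp)
  have e2 := fun p hp => (h' p hp).dens_le ha (hD p hp) (hC p hp) (h p hp)
  have g1 : ∀ p ∈ Ω, dualNorm D p (fderiv ℝ f p) ^ 2 ≤ a ^ 2 * dualNorm C p (fderiv ℝ f p) ^ 2 := by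
    intro p hp
    rw [← mul_pow]
    exact pow_le_pow_left₀ ((hD p hp).dual_nonneg _)
      ((h p hp).dual_le ha (hC p hp) (hD p hp) (h' p hp) _) 2
  have g2 : ∀ p ∈ Ω, dualNorm C p (fderiv ℝ f p) ^ 2 ≤ a ^ 2 * dualNorm D p (fderiv ℝ f p) ^ 2 := by
    intro p hp
    rw [← mul_pow]
    exact pow_le_pow_left₀ ((hC p hp).dual_nonneg _)
      ((h' p hp).dual_le ha (hD p hp) (hC p hp) (h p hp) _) 2
  have mC := dual_meas (hC p₀ hp₀).conv (hC p₀ hp₀).opn (hC p₀ hp₀).bdd hΩ sC f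
  have mD := dual_meas (hD p₀ hp₀).conv (hD p₀ hp₀).opn (hD p₀ hp₀).bdd hΩ sD f
  have mf : AEStronglyMeasurable (fun p => f p ^ 2) (volume.restrict Ω) :=
    (hf.pow 2).aestronglyMeasurable
  have hN := int_le hΩ sC sD hk (by positivity) e1 e2 g1 g2 (fun _ => sq_nonneg _)
    (fun _ => sq_nonneg _) mD mC
  have hD1 := int_le hΩ sC sD hk zero_le_one e1 e2 (F := fun p => f p ^ 2) (G := fun p => f p ^ 2)
    (by simp) (by simp) (fun _ => sq_nonneg _) (fun _ => sq_nonneg _) mf mf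
  have hD2 := int_le hΩ sD sC hk zero_le_one e2 e1 (F := fun p => f p ^ 2) (G := fun p => f p ^ 2)
    (by simp) (by simp) (fun _ => sq_nonneg _) (fun _ => sq_nonneg _) mf mf
  rw [one_mul] at hD1 hD2
  have := div_le_of_two (integral_nonneg fun _ => sq_nonneg _)
    (integral_nonneg fun _ => sq_nonneg _) hk hD1 hD2 (integral_nonneg fun _ => sq_nonneg _) hN
  rw [← pow_add, ← pow_add] at this
  exact this

lemma lambda_le {n : ℕ} {C D Ω : Set (Euc n)} {a : ℝ} (ha : 0 < a) (hΩ : IsOpen Ω)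
    (hC : ∀ p ∈ Ω, HGood C p) (hD : ∀ p ∈ Ω, HGood D p)
    (h : ∀ p ∈ Ω, HilSub a C p D p) (h' : ∀ p ∈ Ω, HilSub a D p C p) :
    lambda1D D Ω ≤ a ^ (2 + n + n) * lambda1D C Ω := by
  rcases (testFuns Ω).eq_empty_or_nonempty with he | hne
  · simp [lambda1D, he]
  have hk : 0 < a ^ (2 + n + n) := by positivity
  rw [← div_le_iff₀' hk]
  refine le_csInf (hne.image _) ?_
  rintro _ ⟨f, hf, rfl⟩
  rw [div_le_iff₀' hk]
  obtain ⟨K, hK⟩ := hf.1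
  refine le_trans ?_ (rayleigh_le ha hΩ hC hD h h' hK.continuous)
  refine csInf_le ⟨0, ?_⟩ ⟨f, hf, rfl⟩
  rintro _ ⟨g, -, rfl⟩
  exact rayleigh_nonneg _ _ _

lemma exists_scale {n : ℕ} {C K : Set (Euc n)} (hopen : IsOpen C) (hK : IsCompact K)
    (hKC : K ⊆ C) (P : Euc n) : ∃ s : ℝ, 1 < s ∧ ∀ p ∈ K, P + s • (p - P) ∈ C := by
  have := hK.eventually_forall_of_forall_eventually (x₀ := (1:ℝ))
    (P := fun s p => P + s • (p - P) ∈ C) (fun y hy => by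
      have hc : Continuous (fun z : ℝ × Euc n => P + z.1 • (z.2 - P)) := by fun_prop
      exact hc.continuousAt.preimage_mem_nhds (hopen.mem_nhds (by simpa using hKC hy)))
  have h2 := (this.filter_mono (nhdsWithin_le_nhds (s := Ioi 1))).and self_mem_nhdsWithin
  obtain ⟨s, h1, h2⟩ := h2.exists
  exact ⟨s, h2, h1⟩

lemma exists_pow_le (m : ℕ) {ε : ℝ} (hε : 0 < ε) : ∃ a : ℝ, 1 < a ∧ a ^ m ≤ 1 + ε := by
  have hc : ContinuousAt (fun a : ℝ => a ^ m) 1 := by fun_prop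
  have := hc.eventually_lt_const (u := 1 + ε) (by simpa using hε)
  have h2 := (this.filter_mono (nhdsWithin_le_nhds (s := Ioi 1))).and self_mem_nhdsWithin
  obtain ⟨s, h1, h2⟩ := h2.exists
  exact ⟨s, h2, h1.le⟩

/-- Sub-convex combinations about a point of a convex set. -/
lemma comb_mem {n : ℕ} {C : Set (Euc n)} (hconv : Convex ℝ C) {P x y : Euc n} (hP : P ∈ C)
    (hx : x ∈ C) (hy : y ∈ C) {α β : ℝ} (hα : 0 ≤ α) (hβ : 0 ≤ β) (h : α + β ≤ 1) :
    P + α • (x - P) + β • (y - P) ∈ C := by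
  have := hconv.sum_mem (t := Finset.univ) (w := ![1 - α - β, α, β]) (z := ![P, x, y])
    (by intro i _; fin_cases i <;> simp <;> linarith)
    (by simp [Fin.sum_univ_three]; ring) (by intro i _; fin_cases i <;> simp [*])
  simp only [Fin.sum_univ_three] at this
  convert this using 1
  simp
  module

/-- given `Ω` open with closure in `C` and `ε > 0`, there is `0 < ρ < 1`
with `closure Ω ⊆ (1-ρ)C` such that every bounded open convex `Γ` squeezed between
`(1-ρ)C` and `(1+ρ)C` satisfies
`(1-ε)·λ₁^C(Ω) ≤ λ₁^Γ(Ω) ≤ (1+ε)·λ₁^C(Ω)`. -/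
theorem stmt6 {n : ℕ} (C : Set (Euc n)) (hconv : Convex ℝ C) (hopen : IsOpen C)
    (hbdd : Bornology.IsBounded C) (hne : C.Nonempty)
    (P₀ : Euc n) (hP₀ : P₀ ∈ C)
    (Ω : Set (Euc n)) (hΩopen : IsOpen Ω) (hΩ : closure Ω ⊆ C)
    (ε : ℝ) (hε : 0 < ε) :
    ∃ ρ : ℝ, 0 < ρ ∧ ρ < 1 ∧ closure Ω ⊆ homoth P₀ (1 - ρ) C ∧
      ∀ Γ : Set (Euc n), Convex ℝ Γ → IsOpen Γ → Bornology.IsBounded Γ →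
        homoth P₀ (1 - ρ) C ⊆ Γ → Γ ⊆ homoth P₀ (1 + ρ) C →
        (1 - ε) * lambda1D C Ω ≤ lambda1D Γ Ω ∧
          lambda1D Γ Ω ≤ (1 + ε) * lambda1D C Ω := by
  obtain ⟨a, ha1, hak⟩ := exists_pow_le (2 + n + n) hε
  have hKc : IsCompact (closure Ω) :=
    Metric.isCompact_of_isClosed_isBounded isClosed_closure (hbdd.subset hΩ)
  obtain ⟨s, hs1, hs⟩ := exists_scale hopen hKc hΩ P₀
  have ha0 : 0 < a := by linarith
  have hs0 : 0 < s := by linarith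
  have hb1 : a⁻¹ < 1 := inv_lt_one_of_one_lt₀ ha1
  have hb0 : 0 < a⁻¹ := by positivity
  have hσ1 : s⁻¹ < 1 := inv_lt_one_of_one_lt₀ hs1
  have hσ0 : 0 < s⁻¹ := by positivity
  set b := a⁻¹ with hb
  set σ := s⁻¹ with hσ
  have hpc : ∀ p : Euc n, p - P₀ = σ • ((P₀ + s • (p - P₀)) - P₀) := by
    intro p
    rw [add_sub_cancel_left, smul_smul, hσ, inv_mul_cancel₀ hs0.ne', one_smul]
  set ρ := (1 - b) * (1 - σ) with hρ
  have hρ0 : 0 < ρ := mul_pos (by linarith) (by linarith)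
  have hρσ : ρ < 1 - σ := by nlinarith
  have hr0 : 0 < 1 - ρ := by linarith
  refine ⟨ρ, hρ0, by linarith, ?_, ?_⟩
  · intro p hp
    have hm := comb_mem hconv hP₀ (hs p hp) hP₀ (α := (1 - ρ)⁻¹ * σ) (β := 0) (by positivity) le_rfl
      (by rw [add_zero, inv_mul_le_iff₀ hr0]; linarith)
    refine ⟨_, hm, ?_⟩
    simp only
    rw [zero_smul, add_zero, add_sub_cancel_left, smul_smul, mul_inv_cancel_left₀ hr0.ne',
      ← hpc p]
    abel
  intro Γ gconv gopen gbdd h1 h2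
  have hin : ∀ p ∈ Ω, HilSub a C p Γ p := by
    intro p hp v hv
    apply h1
    have hm := comb_mem hconv hP₀ hv (hs p (subset_closure hp)) (α := (1 - ρ)⁻¹ * b)
      (β := (1 - ρ)⁻¹ * ((1 - b) * σ)) (by positivity)
      (mul_nonneg (by positivity) (mul_nonneg (by linarith) hσ0.le))
      (by rw [← mul_add, inv_mul_le_iff₀ hr0, hρ]; apply le_of_eq; ring)
    refine ⟨_, hm, ?_⟩
    simp only
    rw [add_assoc, add_sub_cancel_left, smul_add, smul_smul, smul_smul,
      mul_inv_cancel_left₀ hr0.ne', mul_inv_cancel_left₀ hr0.ne', mul_smul (1 - b), ← hpc p]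
    module
  have hout : ∀ p ∈ Ω, HilSub a Γ p C p := by
    intro p hp v hv
    obtain ⟨x, hx, hxv⟩ := h2 hv
    simp only at hxv
    have hm := comb_mem hconv hP₀ hx (hs p (subset_closure hp)) (α := b * (1 + ρ))
      (β := (1 - b) * σ) (by positivity) (mul_nonneg (by linarith) hσ0.le)
      (by nlinarith)
    rw [mul_smul (1 - b), ← hpc p] at hm
    have hv' : v = P₀ + (1 + ρ) • (x - P₀) - p := by rw [hxv]; abel
    rw [hv']
    convert hm using 1
    module
  have gC : ∀ p ∈ Ω, HGood C p := fun p hp => ⟨hconv, hopen, hbdd, hΩ (subset_closure hp)⟩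
  have gG : ∀ p ∈ Ω, HGood Γ p := fun p hp => ⟨gconv, gopen, gbdd, by
    have := hin p hp 0 (by simpa using (gC p hp).mem)
    simpa using this⟩
  have L1 := lambda_le ha0 hΩopen gC gG hin hout
  have L2 := lambda_le ha0 hΩopen gG gC hout hin
  have n1 : 0 ≤ lambda1D C Ω := Real.sInf_nonneg (by
    rintro _ ⟨f, -, rfl⟩; exact rayleigh_nonneg _ _ _)
  have n2 : 0 ≤ lambda1D Γ Ω := Real.sInf_nonneg (by
    rintro _ ⟨f, -, rfl⟩; exact rayleigh_nonneg _ _ _)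
  constructor
  · have L3 : lambda1D C Ω ≤ (1 + ε) * lambda1D Γ Ω := L2.trans (by gcongr)
    rcases le_total 1 ε with h | h
    · exact le_trans (mul_nonpos_of_nonpos_of_nonneg (by linarith) n1) n2
    · calc (1 - ε) * lambda1D C Ω ≤ (1 - ε) * ((1 + ε) * lambda1D Γ Ω) :=
          mul_le_mul_of_nonneg_left L3 (by linarith)
        _ ≤ lambda1D Γ Ω := by nlinarith [mul_nonneg (sq_nonneg ε) n2]
  · exact L1.trans (by gcongr)
end

section
/- Let C be a bounded open convex subset of ℝⁿ such that there exists λ > 0 with λ₁(C ∩ H) ≥ λ for every affine plane H ⊂ ℝⁿ with C ∩ H ≠ ∅. Then there exists δ = δ(λ) ≥ 0 such that (C, d_C) is δ-hyperbolic. -/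
open MeasureTheory Set Filter
open scoped ENNReal NNReal

namespace HB

variable {n : ℕ} {C : Set (Euc n)}

lemma line_ends (hc : Convex ℝ C) (ho : IsOpen C) (hb : Bornology.IsBounded C)
    {p v : Euc n} (hp : p ∈ C) (hv : v ≠ 0) :
    ∃ a b : ℝ, a < 0 ∧ 0 < b ∧ ∀ t : ℝ, p + t • v ∈ C ↔ a < t ∧ t < b := by
  set S : Set ℝ := {t : ℝ | p + t • v ∈ C} with hS
  have hcont : Continuous (fun t : ℝ => p + t • v) := by fun_prop
  have hSo : IsOpen S := ho.preimage hcont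
  have hSc : Convex ℝ S := by
    intro s hs t ht α β hα hβ hαβ
    have := hc hs ht hα hβ hαβ
    simp only [hS, mem_ofPred_eq]
    convert this using 1
    have : p = (α + β) • p := by rw [hαβ, one_smul]
    nth_rewrite 1 [this]
    simp only [smul_eq_mul]
    module
  have h0 : (0:ℝ) ∈ S := by simpa [hS] using hp
  obtain ⟨M, hM⟩ := hb.exists_norm_le
  have hvn : 0 < ‖v‖ := norm_pos_iff.mpr hv
  have hbd : ∀ t ∈ S, |t| ≤ (M + ‖p‖) / ‖v‖ := by
    intro t ht
    rw [le_div_iff₀ hvn]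
    have h1 := hM _ ht
    have h2 : ‖t • v‖ ≤ ‖p + t • v‖ + ‖p‖ := by
      have := norm_sub_le (p + t • v) p
      simpa using this
    rw [norm_smul, Real.norm_eq_abs] at h2
    linarith
  have hba : BddAbove S := ⟨_, fun t ht => (abs_le.mp (hbd t ht)).2⟩
  have hbb : BddBelow S := ⟨_, fun t ht => (abs_le.mp (hbd t ht)).1⟩
  have hlow : ∀ t ∈ S, sInf S < t := by
    intro t ht
    obtain ⟨ε, hε, hball⟩ := Metric.isOpen_iff.mp hSo t ht
    have : t - ε / 2 ∈ S := hball (by simp [abs_of_pos, hε])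
    have := csInf_le hbb this
    linarith
  have hup : ∀ t ∈ S, t < sSup S := by
    intro t ht
    obtain ⟨ε, hε, hball⟩ := Metric.isOpen_iff.mp hSo t ht
    have : t + ε / 2 ∈ S := hball (by simp [abs_of_pos, hε])
    have := le_csSup hba this
    linarith
  refine ⟨sInf S, sSup S, hlow 0 h0, hup 0 h0, fun t => ⟨fun ht => ⟨hlow t ht, hup t ht⟩, ?_⟩⟩
  rintro ⟨h1, h2⟩
  obtain ⟨s, hs, hst⟩ := exists_lt_of_csInf_lt ⟨0, h0⟩ h1
  obtain ⟨s', hs', hst'⟩ := exists_lt_of_lt_csSup ⟨0, h0⟩ h2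
  exact hSc.ordConnected.out hs hs' ⟨hst.le, hst'.le⟩

lemma exists_support (hc : Convex ℝ C) (ho : IsOpen C) {b : Euc n} (hb : b ∉ C) :
    ∃ (c : ℝ) (l : Euc n →L[ℝ] ℝ), (∀ q ∈ C, 0 < c + l q) ∧ c + l b = 0 := by
  obtain ⟨f, hf⟩ := geometric_hahn_banach_open_point hc ho hb
  refine ⟨f b, -f, fun q hq => ?_, by simp⟩
  have := hf q hq
  simp; linarith

lemma hDist_line {p v : Euc n} {a b : ℝ} (hv : v ≠ 0)
    (h : ∀ t : ℝ, p + t • v ∈ C ↔ a < t ∧ t < b) {s t : ℝ} (has : a < s) (hst : s < t)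
    (htb : t < b) :
    hDist C (p + s • v) (p + t • v) =
      (1 / 2) * Real.log (((t - a) * (b - s)) / ((s - a) * (b - t))) := by
  have hd : 0 < t - s := sub_pos.mpr hst
  have hne : p + s • v ≠ p + t • v := by
    intro h
    have h2 : (t - s) • v = 0 := by
      rw [sub_smul, sub_eq_zero]; exact (add_left_cancel h).symm
    rcases smul_eq_zero.mp h2 with h | h
    · linarith
    · exact hv h
  have hset : lineParams C (p + s • v) (p + t • v - (p + s • v))
      = Ioo ((a - s) / (t - s)) ((b - s) / (t - s)) := by
    ext τ
    have : p + s • v + τ • (p + t • v - (p + s • v)) = p + (s + τ * (t - s)) • v := by module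
    simp only [lineParams, mem_ofPred_eq, this, h, mem_Ioo, div_lt_iff₀ hd, lt_div_iff₀ hd]
    constructor <;> rintro ⟨h1, h2⟩ <;> constructor <;> linarith
  have hlt : (a - s) / (t - s) < (b - s) / (t - s) := by
    gcongr; linarith
  rw [hDist, if_neg hne, hset, csInf_Ioo hlt, csSup_Ioo hlt]
  congr 2
  have h1 : s - a ≠ 0 := by linarith
  have h2 : b - t ≠ 0 := by linarith
  have h3 : t - s ≠ 0 := by linarith
  have e1 : 1 - (a - s) / (t - s) = (t - a) / (t - s) := by field_simp; ring
  have e2 : (b - s) / (t - s) - 1 = (b - t) / (t - s) := by field_simp; ring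
  have e3 : -((a - s) / (t - s)) = (s - a) / (t - s) := by field_simp; ring
  rw [e1, e2, e3]
  field_simp

lemma hDist_line' {p v : Euc n} {a b : ℝ} (hv : v ≠ 0)
    (h : ∀ t : ℝ, p + t • v ∈ C ↔ a < t ∧ t < b) {s t : ℝ} (has : a < s) (hst : s < t)
    (htb : t < b) :
    hDist C (p + t • v) (p + s • v) =
      (1 / 2) * Real.log (((t - a) * (b - s)) / ((s - a) * (b - t))) := by
  have h' : ∀ t : ℝ, p + t • (-v) ∈ C ↔ -b < t ∧ t < -a := by
    intro t
    have : p + t • (-v) = p + (-t) • v := by module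
    rw [this, h]
    constructor <;> rintro ⟨h1, h2⟩ <;> constructor <;> linarith
  have := hDist_line (neg_ne_zero.mpr hv) h' (s := -t) (t := -s) (by linarith) (by linarith)
    (by linarith)
  simp only [smul_neg, neg_smul, neg_neg] at this
  rw [this]
  congr 2
  rw [show (-s - -b) = b - s by ring, show -a - -t = t - a by ring, show -t - -b = b - t by ring,
    show -a - -s = s - a by ring]
  ring

lemma hDist_self (p : Euc n) : hDist C p p = 0 := by simp [hDist]

lemma hDist_formula (hc : Convex ℝ C) (ho : IsOpen C) (hb : Bornology.IsBounded C)
    {p q : Euc n} (hp : p ∈ C) (hq : q ∈ C) (hpq : p ≠ q) :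
    ∃ a b : ℝ, a < 0 ∧ 1 < b ∧ (∀ t : ℝ, p + t • (q - p) ∈ C ↔ a < t ∧ t < b) ∧
      hDist C p q = (1 / 2) * Real.log (((1 - a) * b) / ((-a) * (b - 1))) := by
  have hv : q - p ≠ 0 := sub_ne_zero.mpr hpq.symm
  obtain ⟨a, b, ha, hb0, h⟩ := line_ends hc ho hb hp hv
  have h1 : a < 1 ∧ 1 < b := (h 1).mp (by simpa using hq)
  refine ⟨a, b, ha, h1.2, h, ?_⟩
  have := hDist_line hv h (s := 0) (t := 1) ha one_pos h1.2
  simpa using this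

lemma hDist_comm (hc : Convex ℝ C) (ho : IsOpen C) (hb : Bornology.IsBounded C)
    {p q : Euc n} (hp : p ∈ C) (hq : q ∈ C) : hDist C p q = hDist C q p := by
  by_cases hpq : p = q
  · rw [hpq]
  have hv : q - p ≠ 0 := sub_ne_zero.mpr (Ne.symm hpq)
  obtain ⟨a, b, ha, hb0, h⟩ := line_ends hc ho hb hp hv
  have h1 : a < 1 ∧ 1 < b := (h 1).mp (by simpa using hq)
  have e1 := hDist_line hv h (s := 0) (t := 1) ha one_pos h1.2
  have e2 := hDist_line' hv h (s := 0) (t := 1) ha one_pos h1.2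
  simp only [zero_smul, one_smul, add_zero, add_sub_cancel] at e1 e2
  rw [e1, e2]

/-- functionals bound -/
lemma functional_le (hc : Convex ℝ C) (ho : IsOpen C) (hb : Bornology.IsBounded C)
    {p q : Euc n} (hp : p ∈ C) (hq : q ∈ C) {c c' : ℝ} {l l' : Euc n →L[ℝ] ℝ}
    (hL : ∀ x ∈ C, 0 < c + l x) (hL' : ∀ x ∈ C, 0 < c' + l' x) :
    (c + l p) * (c' + l' q) ≤ Real.exp (2 * hDist C p q) * ((c + l q) * (c' + l' p)) := by
  by_cases hpq : p = q
  · subst hpq; simp [hDist_self]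
  obtain ⟨a, b, ha, hb1, h, hd⟩ := hDist_formula hc ho hb hp hq hpq
  have hpos : 0 < ((1 - a) * b) / ((-a) * (b - 1)) := by
    apply div_pos <;> apply mul_pos <;> linarith
  have he : Real.exp (2 * hDist C p q) = ((1 - a) * b) / ((-a) * (b - 1)) := by
    rw [hd, ← mul_assoc, show (2:ℝ) * (1 / 2) = 1 by norm_num, one_mul, Real.exp_log hpos]
  rw [he]
  -- nonnegativity at ends
  have key : ∀ (c : ℝ) (l : Euc n →L[ℝ] ℝ), (∀ x ∈ C, 0 < c + l x) →
      0 ≤ (1 - b) * (c + l p) + b * (c + l q) ∧ 0 ≤ (1 - a) * (c + l p) + a * (c + l q) := by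
    intro c l hl
    have hcl : ∀ t ∈ closure (Ioo a b), 0 ≤ (1 - t) * (c + l p) + t * (c + l q) := by
      intro t ht
      have hclosed : IsClosed {t : ℝ | 0 ≤ (1 - t) * (c + l p) + t * (c + l q)} :=
        isClosed_le continuous_const (by fun_prop)
      refine closure_minimal (fun t ht => ?_) hclosed ht
      have := hl _ ((h t).mpr ht)
      simp only [map_add, map_smul, map_sub, smul_eq_mul] at this
      simp only [mem_ofPred_eq]; nlinarith
    rw [closure_Ioo (by linarith)] at hcl
    exact ⟨hcl b ⟨by linarith, le_rfl⟩, hcl a ⟨le_rfl, by linarith⟩⟩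
  have k1 := (key c l hL).1
  have k2 := (key c' l' hL').2
  have p1 := hL p hp
  have p2 := hL q hq
  have p3 := hL' p hp
  have p4 := hL' q hq
  rw [div_mul_eq_mul_div, le_div_iff₀ (by apply mul_pos <;> linarith)]
  have m1 : (b - 1) * (c + l p) ≤ b * (c + l q) := by linarith
  have m2 : (-a) * (c' + l' q) ≤ (1 - a) * (c' + l' p) := by linarith
  have := mul_le_mul m1 m2 (mul_nonneg (by linarith) p4.le) (mul_nonneg (by linarith) p2.le)
  linarith

lemma functional_eq (hc : Convex ℝ C) (ho : IsOpen C) (hb : Bornology.IsBounded C)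
    {p q : Euc n} (hp : p ∈ C) (hq : q ∈ C) :
    ∃ (c c' : ℝ) (l l' : Euc n →L[ℝ] ℝ), 
    (∀ x ∈ C, 0 < c + l x) ∧ (∀ x ∈ C, 0 < c' + l' x) ∧
    (c + l p) * (c' + l' q) = Real.exp (2 * hDist C p q) * ((c + l q) * (c' + l' p)) := by
  by_cases hpq : p = q
  · subst hpq
    exact ⟨1, 1, 0, 0, by simp, by simp, by simp [hDist_self]⟩
  obtain ⟨a, b, ha, hb1, h, hd⟩ := hDist_formula hc ho hb hp hq hpq
  have hpos : 0 < ((1 - a) * b) / ((-a) * (b - 1)) := by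
    apply div_pos <;> apply mul_pos <;> linarith
  have he : Real.exp (2 * hDist C p q) = ((1 - a) * b) / ((-a) * (b - 1)) := by
    rw [hd, ← mul_assoc, show (2:ℝ) * (1 / 2) = 1 by norm_num, one_mul, Real.exp_log hpos]
  obtain ⟨c, l, hl, hl0⟩ := exists_support hc ho (b := p + b • (q - p)) (by rw [h]; simp)
  obtain ⟨c', l', hl', hl0'⟩ := exists_support hc ho (b := p + a • (q - p)) (by rw [h]; simp)
  refine ⟨c, c', l, l', hl, hl', ?_⟩
  simp only [map_add, map_smul, map_sub, smul_eq_mul] at hl0 hl0'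
  have m1 : (b - 1) * (c + l p) = b * (c + l q) := by linarith
  have m2 : (-a) * (c' + l' q) = (1 - a) * (c' + l' p) := by linarith
  rw [he, div_mul_eq_mul_div, eq_div_iff (by apply ne_of_gt; apply mul_pos <;> linarith)]
  calc _ = ((b - 1) * (c + l p)) * ((-a) * (c' + l' q)) := by ring
    _ = _ := by rw [m1, m2]; ring

lemma hDist_triangle (hc : Convex ℝ C) (ho : IsOpen C) (hb : Bornology.IsBounded C)
    {p q r : Euc n} (hp : p ∈ C) (hq : q ∈ C) (hr : r ∈ C) :
    hDist C p r ≤ hDist C p q + hDist C q r := by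
  obtain ⟨c, c', l, l', hl, hl', e⟩ := functional_eq hc ho hb hp hr
  have h1 := functional_le hc ho hb hp hq hl hl'
  have h2 := functional_le hc ho hb hq hr hl hl'
  have p1 := hl p hp
  have p2 := hl q hq
  have p3 := hl r hr
  have p4 := hl' p hp
  have p5 := hl' q hq
  have p6 := hl' r hr
  have h3 := mul_le_mul h1 h2 (by positivity) (by positivity)
  have : Real.exp (2 * hDist C p r) ≤ Real.exp (2 * hDist C p q) * Real.exp (2 * hDist C q r) := by
    have hpos : 0 < ((c + l r) * (c' + l' p)) * ((c + l q) * (c' + l' q)) := by positivity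
    refine le_of_mul_le_mul_right ?_ hpos
    rw [← mul_assoc, ← e]
    linarith
  rw [← Real.exp_add, Real.exp_le_exp] at this
  linarith

lemma hDist_add (hc : Convex ℝ C) (ho : IsOpen C) (hb : Bornology.IsBounded C)
    {p q r : Euc n} (hp : p ∈ C) (hr : r ∈ C) (hq : q ∈ segment ℝ p r) :
    hDist C p r = hDist C p q + hDist C q r := by
  rw [segment_eq_image'] at hq
  obtain ⟨s, ⟨hs0, hs1⟩, rfl⟩ := hq
  simp only
  by_cases hpr : p = r
  · subst hpr; simp [hDist_self]
  rcases hs0.eq_or_lt with rfl | hs0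
  · simp [hDist_self]
  rcases hs1.eq_or_lt with rfl | hs1
  · simp [hDist_self]
  have hv : r - p ≠ 0 := sub_ne_zero.mpr (Ne.symm hpr)
  obtain ⟨a, b, ha, hb0, h⟩ := line_ends hc ho hb hp hv
  have h1 : a < 1 ∧ 1 < b := (h 1).mp (by simpa using hr)
  have e1 := hDist_line hv h (s := 0) (t := 1) ha one_pos h1.2
  have e2 := hDist_line hv h (s := 0) (t := s) ha hs0 (by linarith)
  have e3 := hDist_line hv h (s := s) (t := 1) (by linarith) hs1 h1.2
  simp only [zero_smul, one_smul, add_zero, add_sub_cancel] at e1 e2 e3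
  rw [e1, e2, e3, ← mul_add, ← Real.log_mul]
  · congr 2
    have : 0 - a ≠ 0 := by linarith
    have : b - 1 ≠ 0 := by linarith
    have : s - a ≠ 0 := by linarith
    have : b - s ≠ 0 := by linarith
    field_simp
  · apply ne_of_gt; apply div_pos <;> apply mul_pos <;> linarith
  · apply ne_of_gt; apply div_pos <;> apply mul_pos <;> linarith

lemma hDist_nonneg (hc : Convex ℝ C) (ho : IsOpen C) (hb : Bornology.IsBounded C)
    {p q : Euc n} (hp : p ∈ C) (hq : q ∈ C) : 0 ≤ hDist C p q := by
  have h1 := hDist_triangle hc ho hb hp hq hp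
  rw [hDist_self, hDist_comm hc ho hb hq hp] at h1
  linarith

/-- local continuity along lines -/
lemma hDist_cont (hc : Convex ℝ C) (ho : IsOpen C) (hb : Bornology.IsBounded C)
    {x y : Euc n} (hx : x ∈ C) (hy : y ∈ C) {σ : ℝ} (h0 : 0 ≤ σ) (h1 : σ ≤ 1) :
    ∃ ρ > 0, ∀ s, 0 ≤ s → s ≤ 1 → |s - σ| < ρ →
      hDist C (x + s • (y - x)) (x + σ • (y - x)) < 1 := by
  by_cases hxy : x = y
  · subst hxy; exact ⟨1, one_pos, by simp [hDist_self]⟩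
  have hv : y - x ≠ 0 := sub_ne_zero.mpr (Ne.symm hxy)
  obtain ⟨a, b, ha, hb0, h⟩ := line_ends hc ho hb hx hv
  have hy1 : a < 1 ∧ 1 < b := (h 1).mp (by simpa using hy)
  set g : ℝ → ℝ := fun s => (1 / 2) * Real.log (((s - a) * (b - σ)) / ((σ - a) * (b - s))) with hg
  have hgc : ContinuousAt g σ := by
    have n1 : (σ - a) * (b - σ) ≠ 0 := by apply ne_of_gt; apply mul_pos <;> linarith
    have n2 : ((σ - a) * (b - σ)) / ((σ - a) * (b - σ)) ≠ 0 := div_ne_zero n1 n1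
    have : ContinuousAt (fun s => ((s - a) * (b - σ)) / ((σ - a) * (b - s))) σ :=
      ContinuousAt.div (by fun_prop) (by fun_prop) n1
    exact continuousAt_const.mul (this.log n2)
  have hg0 : g σ = 0 := by
    have n1 : (σ - a) * (b - σ) ≠ 0 := by apply ne_of_gt; apply mul_pos <;> linarith
    simp [hg, div_self n1]
  obtain ⟨ρ, hρ, hh⟩ := Metric.continuousAt_iff.mp hgc 1 one_pos
  refine ⟨ρ, hρ, fun s hs0 hs1 hs => ?_⟩
  have hh := hh (x := s) (by simpa [Real.dist_eq] using hs)
  rw [hg0, Real.dist_eq, sub_zero] at hh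
  have hh := abs_lt.mp hh
  rcases lt_trichotomy s σ with hlt | rfl | hgt
  · rw [hDist_line hv h (by linarith) hlt (by linarith)]
    have : Real.log ((σ - a) * (b - s) / ((s - a) * (b - σ))) =
        - Real.log (((s - a) * (b - σ)) / ((σ - a) * (b - s))) := by
      rw [← Real.log_inv, inv_div]
    rw [this]
    simp only [hg] at hh; linarith
  · simp [hDist_self]
  · rw [hDist_line' hv h (by linarith) hgt (by linarith)]
    simp only [hg] at hh; linarith

lemma seg_mem (hc : Convex ℝ C) {x y p : Euc n} (hx : x ∈ C) (hy : y ∈ C)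
    (hp : p ∈ segment ℝ x y) : p ∈ C := hc.segment_subset hx hy hp

/-- slim triangles imply the four point condition -/
lemma slim_imp_hyp (hc : Convex ℝ C) (ho : IsOpen C) (hb : Bornology.IsBounded C) {R : ℝ}
    (hslim : ∀ x ∈ C, ∀ y ∈ C, ∀ z ∈ C, ∀ p ∈ segment ℝ x y,
      ∃ m, (m ∈ segment ℝ x z ∨ m ∈ segment ℝ y z) ∧ hDist C p m ≤ R) :
    IsDeltaHyp C (3 * R + 4) := by
  intro x hx y hy z hz t ht
  have hsm := @seg_mem n C hc
  have hcomm := @hDist_comm n C hc ho hb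
  have htri := @hDist_triangle n C hc ho hb
  have hadd := @hDist_add n C hc ho hb
  have hR : 0 ≤ R := by
    obtain ⟨m, hm, hd⟩ := hslim x hx x hx x hx x (by simp)
    have hm' : m ∈ C := by
      rcases hm with h | h <;> exact hsm hx hx h
    exact (hDist_nonneg hc ho hb hx hm').trans hd
  -- center point
  have hcenter : ∃ p ∈ segment ℝ x y, (∃ q ∈ segment ℝ x t, hDist C p q ≤ R) ∧
      ∃ r ∈ segment ℝ y t, hDist C p r ≤ R + 2 := by
    have hps : ∀ s : ℝ, 0 ≤ s → s ≤ 1 → x + s • (y - x) ∈ segment ℝ x y := by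
      intro s h0 h1
      rw [segment_eq_image']; exact ⟨s, ⟨h0, h1⟩, rfl⟩
    set S : Set ℝ := {s | 0 ≤ s ∧ s ≤ 1 ∧ ∃ q ∈ segment ℝ x t, hDist C (x + s • (y - x)) q ≤ R}
      with hS
    have hS0 : (0:ℝ) ∈ S := ⟨le_rfl, zero_le_one, x, left_mem_segment _ _ _, by
      simpa [hDist_self] using hR⟩
    have hSb : BddAbove S := ⟨1, fun s hs => hs.2.1⟩
    have hσ0 : 0 ≤ sSup S := le_csSup hSb hS0
    have hσ1 : sSup S ≤ 1 := csSup_le ⟨0, hS0⟩ fun s hs => hs.2.1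
    obtain ⟨ρ, hρ, hcont⟩ := hDist_cont hc ho hb hx hy hσ0 hσ1
    obtain ⟨s, hs, hsρ⟩ := exists_lt_of_lt_csSup ⟨0, hS0⟩ (show sSup S - ρ < sSup S by linarith)
    have hsle : s ≤ sSup S := le_csSup hSb hs
    have hd1 := hcont s hs.1 hs.2.1 (by rw [abs_lt]; constructor <;> linarith)
    have h2 : ∃ s', 0 ≤ s' ∧ s' ≤ 1 ∧ |s' - sSup S| < ρ ∧
        ∃ r ∈ segment ℝ y t, hDist C (x + s' • (y - x)) r ≤ R := by
      rcases hσ1.eq_or_lt with h1 | h1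
      · refine ⟨1, zero_le_one, le_rfl, by rw [h1]; simpa using hρ, y, left_mem_segment _ _ _, ?_⟩
        simpa [hDist_self] using hR
      · set s' := min 1 (sSup S + ρ / 2) with hs'
        have hlt : sSup S < s' := lt_min h1 (by linarith)
        have hle : s' ≤ sSup S + ρ / 2 := min_le_right _ _
        have hle1 : s' ≤ 1 := min_le_left _ _
        refine ⟨s', by linarith, hle1, by rw [abs_lt]; constructor <;> linarith, ?_⟩
        obtain ⟨m, hm, hd⟩ := hslim x hx y hy t ht _ (hps s' (by linarith) hle1)
        rcases hm with hm | hm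
        · exact absurd (le_csSup hSb (show s' ∈ S from ⟨by linarith, hle1, m, hm, hd⟩))
            (not_le.mpr hlt)
        · exact ⟨m, hm, hd⟩
    obtain ⟨s', hs'0, hs'1, hs'ρ, r, hr, hdr⟩ := h2
    have hd2 := hcont s' hs'0 hs'1 hs'ρ
    have hpC := hsm hx hy (hps s hs.1 hs.2.1)
    have hp'C := hsm hx hy (hps s' hs'0 hs'1)
    have hpσ := hsm hx hy (hps _ hσ0 hσ1)
    have hrC := hsm hy ht hr
    refine ⟨_, hps s hs.1 hs.2.1, hs.2.2, r, hr, ?_⟩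
    have t1 := htri hpC hpσ hrC
    have t2 := htri hpσ hp'C hrC
    rw [hcomm hpσ hp'C] at t2
    linarith
  obtain ⟨p, hp, ⟨q, hq, hpq⟩, r, hr, hpr⟩ := hcenter
  have hpC := hsm hx hy hp
  have hqC := hsm hx ht hq
  have hrC := hsm hy ht hr
  have a1 := hadd hx ht hq
  have a2 := hadd hy ht hr
  have a3 := hadd hx hy hp
  have b1 := htri hx hqC hpC
  have b2 := htri hpC hqC ht
  have b3 := htri hy hrC hpC
  have b4 := htri hpC hrC ht
  have c1 := hcomm hpC hqC
  have c2 := hcomm hpC hrC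
  have c3 := hcomm hpC hy
  have main : hDist C p t - 2 * R - 2 ≤ gromovProd (hDist C) x y t := by
    unfold gromovProd; linarith
  have side : ∀ x ∈ C, ∀ m ∈ segment ℝ x z, hDist C p m ≤ R →
      gromovProd (hDist C) x z t ≤ hDist C p t + R := by
    intro x hx m hm hd
    have hmC := hsm hx hz hm
    have a1 := hadd hx hz hm
    have b1 := htri hx hmC ht
    have b2 := htri hz hmC ht
    have b3 := htri hmC hpC ht
    have c1 := hcomm hpC hmC
    have c2 := hcomm hz hmC
    unfold gromovProd; linarith
  obtain ⟨m, hm, hd⟩ := hslim x hx y hy z hz p hp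
  rcases hm with hm | hm
  · have := side x hx m hm hd
    have := min_le_left (gromovProd (hDist C) x z t) (gromovProd (hDist C) y z t)
    linarith
  · have := side y hy m hm hd
    have := min_le_right (gromovProd (hDist C) x z t) (gromovProd (hDist C) y z t)
    linarith

end HB

namespace HB

lemma vol_ball_two (c : Euc 2) {ρ : ℝ} (hρ : 0 < ρ) :
    volume (Metric.ball c ρ) = ENNReal.ofReal (ρ ^ 2 * omegaVol 2) := by
  rw [Measure.addHaar_ball_of_pos _ _ hρ, ENNReal.ofReal_mul (by positivity), omegaVol,
    ENNReal.ofReal_toReal measure_ball_lt_top.ne]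
  simp

lemma vol_closedBall_two (c : Euc 2) {ρ : ℝ} (hρ : 0 < ρ) :
    volume (Metric.closedBall c ρ) = ENNReal.ofReal (ρ ^ 2 * omegaVol 2) := by
  rw [Measure.addHaar_closedBall _ _ hρ.le, ENNReal.ofReal_mul (by positivity), omegaVol,
    ENNReal.ofReal_toReal measure_ball_lt_top.ne]
  simp

lemma omega_pos : 0 < omegaVol 2 :=
  ENNReal.toReal_pos (Metric.measure_ball_pos _ _ one_pos).ne' measure_ball_lt_top.ne

lemma density_bounds {Ω : Set (Euc 2)} {q : Euc 2} (A : Euc 2 →L[ℝ] Euc 2)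
    (hinj : ∀ u, A u = 0 → u = 0) (h1 : ∀ u, ‖A u‖ ≤ 4 * fNorm Ω q u)
    (h2 : ∀ u, ‖A u‖ < 1 / 16 → fNorm Ω q u < 1) :
    |A.det| / 16 ≤ omegaVol 2 / (volume (tangentBall Ω q 1)).toReal ∧
    omegaVol 2 / (volume (tangentBall Ω q 1)).toReal ≤ 256 * |A.det| := by
  have hω := omega_pos
  have hdet : LinearMap.det (A : Euc 2 →ₗ[ℝ] Euc 2) ≠ 0 := by
    intro h0
    have hk : LinearMap.ker (A : Euc 2 →ₗ[ℝ] Euc 2) = ⊥ :=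
      LinearMap.ker_eq_bot'.mpr hinj
    have := LinearEquiv.isUnit_det' (LinearEquiv.ofInjectiveEndo _ (LinearMap.ker_eq_bot.mp hk))
    apply this.ne_zero
    convert h0
    ext u; rfl
  have hd : A.det ≠ 0 := hdet
  have hdp : 0 < |A.det| := abs_pos.mpr hd
  have s1 : tangentBall Ω q 1 ⊆ A ⁻¹' Metric.ball 0 4 := by
    intro u hu
    have hu : fNorm Ω q u < 1 := hu
    have := h1 u
    simp only [mem_preimage, mem_ball_zero_iff]; linarith
  have s2 : A ⁻¹' Metric.ball 0 (1 / 16) ⊆ tangentBall Ω q 1 := by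
    intro u hu
    simp only [mem_preimage, mem_ball_zero_iff] at hu
    exact h2 u hu
  have v1 := measure_mono (μ := volume) s1
  have v2 := measure_mono (μ := volume) s2
  rw [Measure.addHaar_preimage_continuousLinearMap _ hdet, vol_ball_two _ (by norm_num),
    ← ENNReal.ofReal_mul (by positivity)] at v1 v2
  have hfin : volume (tangentBall Ω q 1) ≠ ⊤ := ne_top_of_le_ne_top ENNReal.ofReal_ne_top v1
  have w1 := ENNReal.toReal_le_of_le_ofReal (by positivity) v1
  have w2 := (ENNReal.ofReal_le_iff_le_toReal hfin).mp v2
  change _ ≤ |(A.det)⁻¹| * _ at w1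
  change |(A.det)⁻¹| * _ ≤ _ at w2
  rw [abs_inv] at w1 w2
  set V := (volume (tangentBall Ω q 1)).toReal with hV
  have hVp : 0 < V := lt_of_lt_of_le (by positivity) w2
  rw [inv_mul_eq_div] at w1 w2
  rw [le_div_iff₀ hdp] at w1
  rw [div_le_iff₀ hdp] at w2
  constructor
  · rw [le_div_iff₀ hVp]; nlinarith
  · rw [div_le_iff₀ hVp]; nlinarith

lemma dualNorm_sq_le {Ω : Set (Euc 2)} {q : Euc 2} {l : Euc 2 →L[ℝ] ℝ} {B : ℝ} (hB : 0 ≤ B)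
    (h : ∀ u, |l u| ≤ B * fNorm Ω q u) : dualNorm Ω q l ^ 2 ≤ B ^ 2 := by
  have hel : ∀ y ∈ ((fun u => l u) '' {u : Euc 2 | fNorm Ω q u = 1}), |y| ≤ B := by
    rintro _ ⟨u, hu, rfl⟩
    have := h u
    have hu : fNorm Ω q u = 1 := hu
    rwa [hu, mul_one] at this
  apply sq_le_sq'
  · rcases Set.eq_empty_or_nonempty ((fun u => l u) '' {u : Euc 2 | fNorm Ω q u = 1}) with he | ⟨y, hy⟩
    · rw [dualNorm, he, Real.sSup_empty]; linarith
    · refine (abs_le.mp (hel y hy)).1.trans (le_csSup ⟨B, fun z hz => (abs_le.mp (hel z hz)).2⟩ hy)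
  · exact Real.sSup_le (fun y hy => (abs_le.mp (hel y hy)).2) hB

lemma dualNorm_zero {Ω : Set (Euc 2)} {q : Euc 2} : dualNorm Ω q 0 = 0 := by
  have := dualNorm_sq_le (Ω := Ω) (q := q) (l := 0) le_rfl (by simp)
  nlinarith [sq_nonneg (dualNorm Ω q 0)]

/-- volume estimates -/
lemma measure_bounds {Ω K : Set (Euc 2)} {Φ : Euc 2 → Euc 2} (hK : MeasurableSet K) (hKΩ : K ⊆ Ω)
    (hΦ : ∀ q ∈ K, DifferentiableAt ℝ Φ q) (hinj : InjOn Φ K)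
    (h0 : ∀ q ∈ K, ∀ u, fderiv ℝ Φ q u = 0 → u = 0)
    (h1 : ∀ q ∈ K, ∀ u, ‖fderiv ℝ Φ q u‖ ≤ 4 * fNorm Ω q u)
    (h2 : ∀ q ∈ K, ∀ u, ‖fderiv ℝ Φ q u‖ < 1 / 16 → fNorm Ω q u < 1) :
    ENNReal.ofReal (1 / 16) * volume (Φ '' K) ≤ hMeasure Ω K ∧
      hMeasure Ω K ≤ ENNReal.ofReal 256 * volume (Φ '' K) := by
  have hcv := lintegral_abs_det_fderiv_eq_addHaar_image volume hK
    (fun q hq => (hΦ q hq).hasFDerivAt.hasFDerivWithinAt) hinj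
  rw [hMeasure, withDensity_apply _ hK, Measure.restrict_restrict hK,
    inter_eq_self_of_subset_left hKΩ, ← hcv]
  constructor
  · rw [← lintegral_const_mul' _ _ ENNReal.ofReal_ne_top]
    refine setLIntegral_mono' hK fun q hq => ?_
    rw [← ENNReal.ofReal_mul (by norm_num)]
    apply ENNReal.ofReal_le_ofReal
    have := (density_bounds _ (h0 q hq) (h1 q hq) (h2 q hq)).1
    linarith
  · rw [← lintegral_const_mul' _ _ ENNReal.ofReal_ne_top]
    refine setLIntegral_mono' hK fun q hq => ?_
    rw [← ENNReal.ofReal_mul (by norm_num)]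
    apply ENNReal.ofReal_le_ofReal
    exact (density_bounds _ (h0 q hq) (h1 q hq) (h2 q hq)).2

lemma spectral_bound : ∃ A : ℝ, 0 < A ∧ ∀ (Ω K : Set (Euc 2)) (Φ : Euc 2 → Euc 2) (c : Euc 2) (r : ℝ),
    0 < r → IsOpen Ω → IsCompact K → K ⊆ Ω →
    (∀ q, q ∈ K ↔ q ∈ Ω ∧ Φ q ∈ Metric.closedBall c (2 * r)) →
    (∀ q ∈ Ω, ContDiffAt ℝ 1 Φ q) → InjOn Φ K →
    Metric.closedBall c r ⊆ Φ '' K →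
    (∀ q ∈ K, ∀ u, fderiv ℝ Φ q u = 0 → u = 0) →
    (∀ q ∈ K, ∀ u, ‖fderiv ℝ Φ q u‖ ≤ 4 * fNorm Ω q u) →
    (∀ q ∈ K, ∀ u, ‖fderiv ℝ Φ q u‖ < 1 / 16 → fNorm Ω q u < 1) →
    lambda1 Ω ≤ A / r ^ 2 := by
  classical
  let b : ContDiffBump (0 : Euc 2) := ⟨1, 2, one_pos, by norm_num⟩
  obtain ⟨κ, hκ⟩ := ContDiff.lipschitzWith_of_hasCompactSupport (𝕂 := ℝ) (n := 1)
    b.hasCompactSupport b.contDiff (by simp)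
  refine ⟨(4 * (κ + 1)) ^ 2 * (256 * 4 * 16), by positivity, ?_⟩
  intro Ω K Φ c r hr hΩ hKc hKΩ hKiff hΦ hinj hsurj h0 h1 h2
  have hω := omega_pos
  set f : Euc 2 → ℝ := fun q => if q ∈ Ω then b (r⁻¹ • (Φ q - c)) else 0 with hf
  have hfΩ : ∀ q ∈ Ω, f =ᶠ[nhds q] fun q => b (r⁻¹ • (Φ q - c)) := by
    intro q hq
    filter_upwards [hΩ.mem_nhds hq] with y hy
    simp [hf, hy]
  have hf0 : ∀ q, q ∉ K → f q = 0 := by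
    intro q hq
    by_cases hqΩ : q ∈ Ω
    · have : ¬ Φ q ∈ Metric.closedBall c (2 * r) := fun h => hq ((hKiff q).mpr ⟨hqΩ, h⟩)
      simp only [hf, hqΩ, if_true]
      apply b.zero_of_le_dist
      rw [Metric.mem_closedBall, not_le, dist_eq_norm] at this
      rw [dist_zero_right, norm_smul, norm_inv, Real.norm_of_nonneg hr.le]
      change (2:ℝ) ≤ _
      rw [inv_mul_eq_div, le_div_iff₀ hr]; linarith
    · simp [hf, hqΩ]
  have hfev : ∀ q, q ∉ K → f =ᶠ[nhds q] fun _ => 0 := by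
    intro q hq
    filter_upwards [hKc.isClosed.isOpen_compl.mem_nhds hq] with y hy using hf0 y hy
  have hfC : ContDiff ℝ 1 f := by
    rw [contDiff_iff_contDiffAt]
    intro q
    by_cases hq : q ∈ K
    · refine ContDiffAt.congr_of_eventuallyEq ?_ (hfΩ q (hKΩ hq))
      have : ContDiffAt ℝ 1 (fun q => r⁻¹ • (Φ q - c)) q :=
        ((hΦ q (hKΩ hq)).sub contDiffAt_const).const_smul r⁻¹
      have hb' : ContDiff ℝ 1 (b : Euc 2 → ℝ) := b.contDiff
      exact hb'.contDiffAt.comp q this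
    · exact ContDiffAt.congr_of_eventuallyEq contDiffAt_const (hfev q hq)
  have hts : tsupport f ⊆ K := by
    refine closure_minimal (fun q hq => ?_) hKc.isClosed
    by_contra h; exact hq (hf0 q h)
  have hfcs : HasCompactSupport f := hKc.of_isClosed_subset (isClosed_tsupport f) hts
  set K1 : Set (Euc 2) := K ∩ Φ ⁻¹' Metric.closedBall c r with hK1
  have hΦK : ContinuousOn Φ K := fun q hq => (hΦ q (hKΩ hq)).continuousAt.continuousWithinAt
  have hK1m : MeasurableSet K1 :=
    (hΦK.preimage_isClosed_of_isClosed hKc.isClosed Metric.isClosed_closedBall).measurableSet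
  have hK1K : K1 ⊆ K := inter_subset_left
  have him : Φ '' K1 = Metric.closedBall c r := by
    rw [hK1, image_inter_preimage]; exact inter_eq_self_of_subset_right hsurj
  have hdiff : ∀ q ∈ Ω, DifferentiableAt ℝ Φ q := fun q hq => (hΦ q hq).differentiableAt (by simp)
  have mK := (measure_bounds hKc.measurableSet hKΩ (fun q hq => hdiff q (hKΩ hq)) hinj h0 h1 h2).2
  have mK1 := (measure_bounds hK1m (hK1K.trans hKΩ) (fun q hq => hdiff q (hKΩ (hK1K hq)))
    (hinj.mono hK1K) (fun q hq => h0 q (hK1K hq)) (fun q hq => h1 q (hK1K hq))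
    (fun q hq => h2 q (hK1K hq))).1
  have hsub : Φ '' K ⊆ Metric.closedBall c (2 * r) := by
    rintro _ ⟨q, hq, rfl⟩; exact ((hKiff q).mp hq).2
  replace mK := mK.trans (mul_le_mul_right (measure_mono (μ := volume) hsub) _)
  rw [him] at mK1
  rw [vol_closedBall_two _ (by positivity), ← ENNReal.ofReal_mul (by norm_num)] at mK mK1
  set ν := (hMeasure Ω).restrict Ω with hν
  have νK : ν K = hMeasure Ω K := by
    rw [hν, Measure.restrict_apply hKc.measurableSet, inter_eq_self_of_subset_left hKΩ]
  have νK1 : ν K1 = hMeasure Ω K1 := by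
    rw [hν, Measure.restrict_apply hK1m, inter_eq_self_of_subset_left (hK1K.trans hKΩ)]
  rw [← νK] at mK
  rw [← νK1] at mK1
  have νKfin : ν K ≠ ⊤ := ne_top_of_le_ne_top ENNReal.ofReal_ne_top mK
  have νK1fin : ν K1 ≠ ⊤ := ne_top_of_le_ne_top νKfin (measure_mono hK1K)
  have mKr := ENNReal.toReal_le_of_le_ofReal (by positivity) mK
  have mK1r := (ENNReal.ofReal_le_iff_le_toReal νK1fin).mp mK1
  have hf1 : ∀ q ∈ K1, f q = 1 := by
    intro q hq
    have hqΩ := hKΩ (hK1K hq)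
    have h3 : Φ q ∈ Metric.closedBall c r := hq.2
    simp only [hf, hqΩ, if_true]
    apply b.one_of_mem_closedBall
    rw [mem_closedBall_zero_iff, norm_smul, norm_inv, Real.norm_of_nonneg hr.le]
    change _ ≤ (1:ℝ)
    rw [Metric.mem_closedBall, dist_eq_norm] at h3
    rw [inv_mul_eq_div, div_le_iff₀ hr]; linarith
  have hf01 : ∀ q, 0 ≤ f q ∧ f q ≤ 1 := by
    intro q
    simp only [hf]
    split_ifs
    · exact ⟨b.nonneg, b.le_one⟩
    · simp
  -- denominator
  have hden : (ν K1).toReal ≤ ∫ q, f q ^ 2 ∂ν := by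
    have hi : Integrable (K1.indicator (fun _ => (1:ℝ))) ν :=
      (integrable_indicator_iff hK1m).mpr (integrableOn_const νK1fin)
    have hiK : Integrable (K.indicator (fun _ => (1:ℝ))) ν :=
      (integrable_indicator_iff hKc.measurableSet).mpr (integrableOn_const νKfin)
    have hif : Integrable (fun q => f q ^ 2) ν := by
      refine hiK.mono' (hfC.continuous.pow 2).aestronglyMeasurable (ae_of_all _ fun q => ?_)
      rw [Real.norm_of_nonneg (sq_nonneg _)]
      by_cases hq : q ∈ K
      · simp only [hq, indicator_of_mem]; have := hf01 q; nlinarith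
      · simp [hq, hf0 q hq]
    have := integral_mono hi hif (fun q => by
      by_cases hq : q ∈ K1
      · simp [hq, hf1 q hq]
      · simp [hq, sq_nonneg])
    rwa [integral_indicator hK1m, setIntegral_const, smul_eq_mul, mul_one] at this
  set B : ℝ := 4 * (κ + 1) / r with hB
  have hBpos : 0 < B := by positivity
  have hder : ∀ q ∈ K, ∀ u, |fderiv ℝ f q u| ≤ B * fNorm Ω q u := by
    intro q hq u
    have hqΩ := hKΩ hq
    rw [(hfΩ q hqΩ).fderiv_eq]
    have hd1 : HasFDerivAt (fun q => r⁻¹ • (Φ q - c)) (r⁻¹ • fderiv ℝ Φ q) q :=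
      ((hdiff q hqΩ).hasFDerivAt.sub_const c).const_smul r⁻¹
    have hd2 : DifferentiableAt ℝ b (r⁻¹ • (Φ q - c)) :=
      (b.contDiffAt (n := 1)).differentiableAt (by simp)
    have hd3 := hd2.hasFDerivAt.comp q hd1
    have : fderiv ℝ (fun q => b (r⁻¹ • (Φ q - c))) q = _ := hd3.fderiv
    rw [this]
    have hle : ‖fderiv ℝ b (r⁻¹ • (Φ q - c))‖ ≤ κ := norm_fderiv_le_of_lipschitz ℝ hκ
    rw [← Real.norm_eq_abs]
    calc ‖(fderiv ℝ b (r⁻¹ • (Φ q - c))) (r⁻¹ • fderiv ℝ Φ q u)‖ 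
        ≤ κ * ‖r⁻¹ • fderiv ℝ Φ q u‖ := ContinuousLinearMap.le_of_opNorm_le _ hle _
      _ = κ * r⁻¹ * ‖fderiv ℝ Φ q u‖ := by
          rw [norm_smul, norm_inv, Real.norm_of_nonneg hr.le]; ring
      _ ≤ (κ + 1) * r⁻¹ * (4 * fNorm Ω q u) := by
          gcongr
          · linarith
          · exact h1 q hq u
      _ = _ := by rw [hB]; ring
  have hnum : ∫ q, dualNorm Ω q (fderiv ℝ f q) ^ 2 ∂ν ≤ B ^ 2 * (ν K).toReal := by
    have hiK : Integrable (K.indicator (fun _ => B ^ 2)) ν :=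
      (integrable_indicator_iff hKc.measurableSet).mpr (integrableOn_const νKfin)
    have := integral_mono_of_nonneg (μ := ν) (f := fun q => dualNorm Ω q (fderiv ℝ f q) ^ 2)
      (ae_of_all _ fun q => sq_nonneg _) hiK (ae_of_all _ fun q => by
        by_cases hq : q ∈ K
        · simp only [hq, indicator_of_mem]
          exact dualNorm_sq_le hBpos.le (hder q hq)
        · have : fderiv ℝ f q = 0 := by rw [(hfev q hq).fderiv_eq]; simp
          simp [hq, this, dualNorm_zero])
    rw [integral_indicator hKc.measurableSet, setIntegral_const, smul_eq_mul, mul_comm] at this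
    exact this
  have hK1pos : 0 < (ν K1).toReal := lt_of_lt_of_le (by positivity) mK1r
  have hray : rayleigh Ω Ω f ≤ (4 * (κ + 1)) ^ 2 * (256 * 4 * 16) / r ^ 2 := by
    rw [rayleigh, div_le_iff₀ (hK1pos.trans_le hden)]
    calc _ ≤ B ^ 2 * (ν K).toReal := hnum
      _ ≤ B ^ 2 * (256 * ((2 * r) ^ 2 * omegaVol 2)) := by gcongr
      _ = (4 * (κ + 1)) ^ 2 * (256 * 4 * 16) / r ^ 2 * (1 / 16 * (r ^ 2 * omegaVol 2)) := by
          rw [hB]; field_simp; ring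
      _ ≤ _ := by gcongr; exact mK1r.trans hden
  have hfne : f ≠ 0 := by
    intro h
    obtain ⟨q, hq⟩ : K1.Nonempty := by
      have : (Φ '' K1).Nonempty := by rw [him]; exact ⟨c, Metric.mem_closedBall_self hr.le⟩
      exact this.of_image
    have := hf1 q hq
    rw [h] at this; simp at this
  refine le_trans (csInf_le ⟨0, ?_⟩ ⟨f, ⟨?_, hfne, hfcs, hts.trans hKΩ⟩, rfl⟩) hray
  · rintro _ ⟨g, -, rfl⟩
    exact div_nonneg (integral_nonneg fun q => sq_nonneg _) (integral_nonneg fun q => sq_nonneg _)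
  · exact ContDiff.lipschitzWith_of_hasCompactSupport (𝕂 := ℝ) (n := 1) hfcs hfC (by simp)

end HB

namespace HB

/-- linear algebra estimate -/
lemma core {A B D X Y Z x1 x2 x3 y1 y2 y3 z1 z2 ε : ℝ}
    (hX : A * x1 + B * y1 + D * z1 = X) (hY : A * x2 + B * y2 + D * z2 = Y)
    (hZ : A * x3 + B * y3 + D * 1 = Z)
    (e1 : x1 + y1 = 1) (e2 : x2 + y2 = 1) (e3 : x3 + y3 = 1)
    (px1 : 0 ≤ x1) (px3 : 0 ≤ x3) (py2 : 0 ≤ y2) (py3 : 0 ≤ y3) (pz1 : 0 ≤ z1) (pz2 : 0 ≤ z2)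
    (s1 : x1 + z1 ≤ ε) (s2 : y2 + z2 ≤ ε) (hε : ε ≤ 1 / 256) :
    |B - X| ≤ ε * (|A| + |B| + |D|) ∧ |A - Y| ≤ ε * (|A| + |B| + |D|) ∧
    |D - Z| ≤ |A| + |B| ∧ |A| + |B| + |D| ≤ 2 * (|Z| + 2 * |X| + 2 * |Y|) := by
  have a1 := neg_abs_le A
  have a2 := le_abs_self A
  have b1 := neg_abs_le B
  have b2 := le_abs_self B
  have d1 := neg_abs_le D
  have d2 := le_abs_self D
  have nA := abs_nonneg A
  have nB := abs_nonneg B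
  have nD := abs_nonneg D
  have hε0 : 0 ≤ ε := by linarith
  have q1 : |B - X| ≤ ε * (|A| + |B| + |D|) := by
    have e : B - X = (B - A) * x1 - D * z1 := by rw [← hX, show y1 = 1 - x1 by linarith]; ring
    rw [e, abs_le]; constructor <;> nlinarith
  have q2 : |A - Y| ≤ ε * (|A| + |B| + |D|) := by
    have e : A - Y = (A - B) * y2 - D * z2 := by rw [← hY, show x2 = 1 - y2 by linarith]; ring
    rw [e, abs_le]; constructor <;> nlinarith
  have q3 : |D - Z| ≤ |A| + |B| := by
    have e : D - Z = -(A * x3 + B * y3) := by linarith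
    rw [e, abs_neg, abs_le]; constructor <;> nlinarith
  refine ⟨q1, q2, q3, ?_⟩
  have t1 : |B| ≤ |B - X| + |X| := by simpa using abs_add_le (B - X) X
  have t2 : |A| ≤ |A - Y| + |Y| := by simpa using abs_add_le (A - Y) Y
  have t3 : |D| ≤ |D - Z| + |Z| := by simpa using abs_add_le (D - Z) Z
  have : ε * (|A| + |B| + |D|) ≤ 1 / 256 * (|A| + |B| + |D|) := by gcongr
  have := abs_nonneg X
  have := abs_nonneg Y
  have := abs_nonneg Z
  linarith

section fn
variable {n : ℕ} {C : Set (Euc n)}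

lemma fNorm_formula (hc : Convex ℝ C) (ho : IsOpen C) (hb : Bornology.IsBounded C)
    {p u : Euc n} (hp : p ∈ C) (hu : u ≠ 0) :
    ∃ a b : ℝ, a < 0 ∧ 0 < b ∧ (∀ t : ℝ, p + t • u ∈ C ↔ a < t ∧ t < b) ∧
      fNorm C p u = (1 / 2) * (1 / b - 1 / a) := by
  obtain ⟨a, b, ha, hb0, h⟩ := line_ends hc ho hb hp hu
  refine ⟨a, b, ha, hb0, h, ?_⟩
  have : lineParams C p u = Ioo a b := by ext t; exact h t
  rw [fNorm, if_neg hu, this, csInf_Ioo (by linarith), csSup_Ioo (by linarith)]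

lemma fNorm_lt_one (hc : Convex ℝ C) (ho : IsOpen C) (hb : Bornology.IsBounded C)
    {p u : Euc n} (hp : p ∈ C) (h1 : p + (3 / 2 : ℝ) • u ∈ C) (h2 : p + (-(3 / 2) : ℝ) • u ∈ C) :
    fNorm C p u < 1 := by
  by_cases hu : u = 0
  · simp [fNorm, hu]
  obtain ⟨a, b, ha, hb0, h, e⟩ := fNorm_formula hc ho hb hp hu
  have k1 := ((h _).mp h1).2
  have k2 := ((h _).mp h2).1
  rw [e]
  have m1 : 1 / b ≤ 1 / (3 / 2) := one_div_le_one_div_of_le (by norm_num) k1.le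
  have m2 : 1 / (-a) ≤ 1 / (3 / 2) := one_div_le_one_div_of_le (by norm_num) (by linarith)
  rw [one_div_neg_eq_neg_one_div] at m2
  linarith

lemma le_fNorm (hc : Convex ℝ C) (ho : IsOpen C) (hb : Bornology.IsBounded C)
    {p : Euc n} (u : Euc n) (hp : p ∈ C) {c c' : ℝ} {l l' : Euc n →L[ℝ] ℝ}
    (hL : ∀ x ∈ C, 0 < c + l x) (hL' : ∀ x ∈ C, 0 < c' + l' x) :
    |l u / (c + l p) - l' u / (c' + l' p)| ≤ 2 * fNorm C p u := by
  by_cases hu : u = 0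
  · simp [fNorm, hu]
  obtain ⟨a, b, ha, hb0, h, e⟩ := fNorm_formula hc ho hb hp hu
  have key : ∀ (c : ℝ) (l : Euc n →L[ℝ] ℝ), (∀ x ∈ C, 0 < c + l x) →
      -(1 / b) ≤ l u / (c + l p) ∧ l u / (c + l p) ≤ -(1 / a) := by
    intro c l hl
    have hcl : ∀ t ∈ closure (Ioo a b), 0 ≤ (c + l p) + t * l u := by
      intro t ht
      have hclosed : IsClosed {t : ℝ | 0 ≤ (c + l p) + t * l u} :=
        isClosed_le continuous_const (by fun_prop)
      refine closure_minimal (fun t ht => ?_) hclosed ht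
      have := hl _ ((h t).mpr ht)
      simp only [map_add, map_smul, smul_eq_mul] at this
      simp only [mem_ofPred_eq]; linarith
    rw [closure_Ioo (by linarith)] at hcl
    have k1 := hcl b ⟨by linarith, le_rfl⟩
    have k2 := hcl a ⟨le_rfl, by linarith⟩
    have pp := hl p hp
    constructor
    · rw [← neg_div, div_le_div_iff₀ hb0 pp]; linarith
    · rw [← one_div_neg_eq_neg_one_div, div_le_div_iff₀ pp (by linarith)]; linarith
  have k1 := key c l hL
  have k2 := key c' l' hL'
  rw [e, abs_le]; constructor <;> linarith

end fn

section config

variable {Ω : Set (Euc 2)}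

lemma tri_mem (hc : Convex ℝ Ω) {x y z : Euc 2} (hx : x ∈ Ω) (hy : y ∈ Ω) (hz : z ∈ Ω)
    {a b d : ℝ} (ha : 0 ≤ a) (hb : 0 ≤ b) (hd : 0 ≤ d) (h : a + b + d = 1) :
    a • x + b • y + d • z ∈ Ω := by
  have := hc.sum_mem (t := Finset.univ) (w := ![a, b, d]) (z := ![x, y, z])
    (by intro i _; fin_cases i <;> simpa) (by simpa [Fin.sum_univ_three] using h)
    (by intro i _; fin_cases i <;> simpa)
  simpa [Fin.sum_univ_three] using this

/-- The near-triangle configuration. -/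
structure Config (Ω : Set (Euc 2)) (x y z : Euc 2) (α β γ ε c1 c2 c3 : ℝ)
    (l1 l2 l3 : Euc 2 →L[ℝ] ℝ) : Prop where
  hc : Convex ℝ Ω
  ho : IsOpen Ω
  hb : Bornology.IsBounded Ω
  hx : x ∈ Ω
  hy : y ∈ Ω
  hz : z ∈ Ω
  hα : 0 < α
  hβ : 0 < β
  hγ : 0 < γ
  hspan : ∀ w : Euc 2, ∃ a b : ℝ, w = a • (x - z) + b • (y - z)
  p1 : ∀ q ∈ Ω, 0 < c1 + l1 q
  p2 : ∀ q ∈ Ω, 0 < c2 + l2 q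
  p3 : ∀ q ∈ Ω, 0 < c3 + l3 q
  e1 : α * (c1 + l1 x) + β * (c1 + l1 y) = 1
  e2 : α * (c2 + l2 x) + β * (c2 + l2 y) = 1
  e3 : α * (c3 + l3 x) + β * (c3 + l3 y) = 1
  s1 : α * (c1 + l1 x) + γ * (c1 + l1 z) ≤ ε
  s2 : β * (c2 + l2 y) + γ * (c2 + l2 z) ≤ ε
  s3 : γ * (c3 + l3 z) = 1
  hε : ε ≤ 1 / 256

namespace Config

variable {x y z : Euc 2} {α β γ ε c1 c2 c3 : ℝ} {l1 l2 l3 : Euc 2 →L[ℝ] ℝ}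

lemma core (h : Config Ω x y z α β γ ε c1 c2 c3 l1 l2 l3) {A B D X Y Z : ℝ}
    (hX : A * (α * (c1 + l1 x)) + B * (β * (c1 + l1 y)) + D * (γ * (c1 + l1 z)) = X)
    (hY : A * (α * (c2 + l2 x)) + B * (β * (c2 + l2 y)) + D * (γ * (c2 + l2 z)) = Y)
    (hZ : A * (α * (c3 + l3 x)) + B * (β * (c3 + l3 y)) + D * (γ * (c3 + l3 z)) = Z) :
    |B - X| ≤ ε * (|A| + |B| + |D|) ∧ |A - Y| ≤ ε * (|A| + |B| + |D|) ∧
    |D - Z| ≤ |A| + |B| ∧ |A| + |B| + |D| ≤ 2 * (|Z| + 2 * |X| + 2 * |Y|) := by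
  have hα := h.hα
  have hβ := h.hβ
  have hγ := h.hγ
  rw [h.s3] at hZ
  exact HB.core hX hY hZ h.e1 h.e2 h.e3 (mul_pos hα (h.p1 x h.hx)).le
    (mul_pos hα (h.p3 x h.hx)).le (mul_pos hβ (h.p2 y h.hy)).le (mul_pos hβ (h.p3 y h.hy)).le
    (mul_pos hγ (h.p1 z h.hz)).le (mul_pos hγ (h.p2 z h.hz)).le h.s1 h.s2 h.hε

/-- coordinates of a point -/
lemma coords (h : Config Ω x y z α β γ ε c1 c2 c3 l1 l2 l3) (q : Euc 2) :
    ∃ A B D : ℝ, α * A + β * B + γ * D = 1 ∧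
      q = (α * A) • x + (β * B) • y + (γ * D) • z := by
  obtain ⟨a, b, hab⟩ := h.hspan (q - z)
  have hα := h.hα.ne'
  have hβ := h.hβ.ne'
  have hγ := h.hγ.ne'
  refine ⟨a / α, b / β, (1 - a - b) / γ, by field_simp; ring, ?_⟩
  rw [mul_div_cancel₀ _ hα, mul_div_cancel₀ _ hβ, mul_div_cancel₀ _ hγ]
  have : q = z + (q - z) := by abel
  rw [this, hab]; module

lemma coordsV (h : Config Ω x y z α β γ ε c1 c2 c3 l1 l2 l3) (u : Euc 2) :
    ∃ A B D : ℝ, α * A + β * B + γ * D = 0 ∧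
      u = (α * A) • x + (β * B) • y + (γ * D) • z := by
  obtain ⟨a, b, hab⟩ := h.hspan u
  have hα := h.hα.ne'
  have hβ := h.hβ.ne'
  have hγ := h.hγ.ne'
  refine ⟨a / α, b / β, (- a - b) / γ, by field_simp; ring, ?_⟩
  rw [mul_div_cancel₀ _ hα, mul_div_cancel₀ _ hβ, mul_div_cancel₀ _ hγ]
  rw [hab]; module

lemma eval_pt {A B D : ℝ} (hs : α * A + β * B + γ * D = 1) (c : ℝ) (l : Euc 2 →L[ℝ] ℝ) :
    c + l ((α * A) • x + (β * B) • y + (γ * D) • z) =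
      A * (α * (c + l x)) + B * (β * (c + l y)) + D * (γ * (c + l z)) := by
  simp only [map_add, map_smul, smul_eq_mul]
  linear_combination (-c) * hs

lemma eval_vec {A B D : ℝ} (hs : α * A + β * B + γ * D = 0) (c : ℝ) (l : Euc 2 →L[ℝ] ℝ) :
    l ((α * A) • x + (β * B) • y + (γ * D) • z) =
      A * (α * (c + l x)) + B * (β * (c + l y)) + D * (γ * (c + l z)) := by
  simp only [map_add, map_smul, smul_eq_mul]
  linear_combination (-c) * hs

lemma not_all_zero (h : Config Ω x y z α β γ ε c1 c2 c3 l1 l2 l3) (q : Euc 2)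
    (h1 : c1 + l1 q = 0) (h2 : c2 + l2 q = 0) (h3 : c3 + l3 q = 0) : False := by
  obtain ⟨A, B, D, hs, rfl⟩ := h.coords q
  rw [eval_pt hs] at h1 h2 h3
  have := (h.core h1 h2 h3).2.2.2
  simp only [abs_zero] at this
  have nA := abs_nonneg A
  have nB := abs_nonneg B
  have nD := abs_nonneg D
  have : A = 0 := abs_eq_zero.mp (by linarith)
  have : B = 0 := abs_eq_zero.mp (by linarith)
  have : D = 0 := abs_eq_zero.mp (by linarith)
  subst A B D
  simp at hs

/-- a solution with data in the box is positive -/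
lemma pos_of_box (h : Config Ω x y z α β γ ε c1 c2 c3 l1 l2 l3) {η : ℝ} (hη : 32 * ε ≤ η)
    {A B D X Y : ℝ}
    (hX : A * (α * (c1 + l1 x)) + B * (β * (c1 + l1 y)) + D * (γ * (c1 + l1 z)) = X)
    (hY : A * (α * (c2 + l2 x)) + B * (β * (c2 + l2 y)) + D * (γ * (c2 + l2 z)) = Y)
    (hZ : A * (α * (c3 + l3 x)) + B * (β * (c3 + l3 y)) + D * (γ * (c3 + l3 z)) = 1)
    (hη0 : 0 < η) (X1 : η ≤ X) (X2 : X ≤ 1 / 16) (Y1 : η ≤ Y) (Y2 : Y ≤ 1 / 16) :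
    7 / 8 * X ≤ B ∧ 7 / 8 * Y ≤ A ∧ 1 / 2 ≤ D := by
  obtain ⟨k1, k2, k3, k4⟩ := h.core hX hY hZ
  have hε0 : 0 ≤ ε := le_trans (by
    have := mul_pos h.hα (h.p1 x h.hx); have := mul_pos h.hγ (h.p1 z h.hz); linarith) h.s1
  rw [abs_one, abs_of_pos (by linarith : 0 < X), abs_of_pos (by linarith : 0 < Y)] at k4
  have k5 : ε * (|A| + |B| + |D|) ≤ ε * (5 / 2) := by gcongr; linarith
  have r1 := abs_le.mp (k1.trans k5)
  have r2 := abs_le.mp (k2.trans k5)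
  have hB : 7 / 8 * X ≤ B := by linarith
  have hA : 7 / 8 * Y ≤ A := by linarith
  refine ⟨hB, hA, ?_⟩
  rw [abs_of_pos (by linarith : 0 < A), abs_of_pos (by linarith : 0 < B)] at k3
  have r3 := abs_le.mp k3
  linarith

set_option maxHeartbeats 2000000 in
lemma mem_of_box (h : Config Ω x y z α β γ ε c1 c2 c3 l1 l2 l3) {η : ℝ} (hη : 32 * ε ≤ η)
    (hη0 : 0 < η) {q : Euc 2} (h3 : 0 < c3 + l3 q)
    (X1 : η ≤ (c1 + l1 q) / (c3 + l3 q)) (X2 : (c1 + l1 q) / (c3 + l3 q) ≤ 1 / 16)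
    (Y1 : η ≤ (c2 + l2 q) / (c3 + l3 q)) (Y2 : (c2 + l2 q) / (c3 + l3 q) ≤ 1 / 16) :
    q ∈ Ω ∧ ∀ u : Euc 2, |l1 u / (c1 + l1 q) - l3 u / (c3 + l3 q)| ≤ 1 / 16 →
      |l2 u / (c2 + l2 q) - l3 u / (c3 + l3 q)| ≤ 1 / 16 →
      ∀ τ : ℝ, |τ| ≤ 3 / 2 → q + τ • u ∈ Ω := by
  obtain ⟨A, B, D, hs, hq⟩ := h.coords q
  set ℓ := c3 + l3 q with hℓ
  set X := (c1 + l1 q) / ℓ with hXd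
  set Y := (c2 + l2 q) / ℓ with hYd
  have hα := h.hα
  have hβ := h.hβ
  have hγ := h.hγ
  have E1 : c1 + l1 q = X * ℓ := by rw [hXd]; field_simp
  have E2 : c2 + l2 q = Y * ℓ := by rw [hYd]; field_simp
  have F1 := eval_pt (x := x) (y := y) (z := z) hs c1 l1
  have F2 := eval_pt (x := x) (y := y) (z := z) hs c2 l2
  have F3 := eval_pt (x := x) (y := y) (z := z) hs c3 l3
  rw [← hq] at F1 F2 F3
  have key := h.pos_of_box hη (A := A / ℓ) (B := B / ℓ) (D := D / ℓ) (X := X) (Y := Y)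
    (by rw [hXd, F1]; ring) (by rw [hYd, F2]; ring)
    (by
      have : A / ℓ * (α * (c3 + l3 x)) + B / ℓ * (β * (c3 + l3 y)) + D / ℓ * (γ * (c3 + l3 z))
        = (c3 + l3 q) / ℓ := by rw [F3]; ring
      rw [this, ← hℓ, div_self h3.ne']) hη0 X1 X2 Y1 Y2
  obtain ⟨kB, kA, kD⟩ := key
  rw [le_div_iff₀ h3] at kA kB kD
  have hXp : 0 < X := by linarith
  have hYp : 0 < Y := by linarith
  have hXℓ : 0 < X * ℓ := mul_pos hXp h3
  have hYℓ : 0 < Y * ℓ := mul_pos hYp h3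
  have hA : 0 < A := by linarith
  have hB : 0 < B := by linarith
  have hD : 0 < D := by linarith
  constructor
  · rw [hq]; exact tri_mem h.hc h.hx h.hy h.hz (by positivity) (by positivity) (by positivity) hs
  intro u hu1 hu2 τ hτ
  obtain ⟨Au, Bu, Du, hsu, hu⟩ := h.coordsV u
  have G1 := eval_vec (x := x) (y := y) (z := z) hsu c1 l1
  have G2 := eval_vec (x := x) (y := y) (z := z) hsu c2 l2
  have G3 := eval_vec (x := x) (y := y) (z := z) hsu c3 l3
  rw [← hu] at G1 G2 G3
  set k := l3 u / ℓ with hk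
  set v1 := l1 u / (c1 + l1 q) - k with hv1
  set v2 := l2 u / (c2 + l2 q) - k with hv2
  have I1 : l1 u - k * (c1 + l1 q) = v1 * (X * ℓ) := by
    rw [hv1, ← E1]
    have : c1 + l1 q ≠ 0 := by rw [E1]; exact hXℓ.ne'
    field_simp
  have I2 : l2 u - k * (c2 + l2 q) = v2 * (Y * ℓ) := by
    rw [hv2, ← E2]
    have : c2 + l2 q ≠ 0 := by rw [E2]; exact hYℓ.ne'
    field_simp
  have I3 : l3 u - k * (c3 + l3 q) = 0 := by
    rw [hk, ← hℓ]; field_simp; ring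
  obtain ⟨k1, k2, k3, k4⟩ := h.core (A := Au - k * A) (B := Bu - k * B) (D := Du - k * D)
    (X := v1 * (X * ℓ)) (Y := v2 * (Y * ℓ)) (Z := 0)
    (by rw [← I1, F1, G1]; ring) (by rw [← I2, F2, G2]; ring) (by rw [← I3, F3, G3]; ring)
  rw [abs_mul, abs_of_pos hXℓ] at k4
  rw [abs_mul, abs_of_pos hYℓ, abs_zero] at k4
  have hε0 : 0 ≤ ε := le_trans (by
    have := mul_pos h.hα (h.p1 x h.hx); have := mul_pos h.hγ (h.p1 z h.hz); linarith) h.s1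
  have m1 : |v1| * (X * ℓ) ≤ 1 / 16 * (X * ℓ) := by gcongr
  have m2 : |v2| * (Y * ℓ) ≤ 1 / 16 * (Y * ℓ) := by gcongr
  have m3 : X * ℓ ≤ 1 / 16 * ℓ := by gcongr
  have m4 : Y * ℓ ≤ 1 / 16 * ℓ := by gcongr
  have m5 : η * ℓ ≤ X * ℓ := by gcongr
  have m6 : η * ℓ ≤ Y * ℓ := by gcongr
  set S := |Au - k * A| + |Bu - k * B| + |Du - k * D| with hS
  have hSle : S ≤ ℓ := by linarith only [k4, m1, m2, m3, m4, h3]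
  have m7 : ε * S ≤ ε * ℓ := by gcongr
  have m8 : 32 * (ε * ℓ) ≤ η * ℓ := by rw [← mul_assoc]; gcongr
  have t1 : |Bu - k * B| ≤ ε * S + |v1| * (X * ℓ) := by
    have := abs_add_le (Bu - k * B - v1 * (X * ℓ)) (v1 * (X * ℓ))
    rw [sub_add_cancel, abs_mul v1, abs_of_pos hXℓ] at this; linarith
  have t2 : |Au - k * A| ≤ ε * S + |v2| * (Y * ℓ) := by
    have := abs_add_le (Au - k * A - v2 * (Y * ℓ)) (v2 * (Y * ℓ))
    rw [sub_add_cancel, abs_mul v2, abs_of_pos hYℓ] at this; linarith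
  rw [sub_zero] at k3
  have u1 : |Bu - k * B| ≤ B / 4 := by linarith only [t1, m1, m5, m7, m8, kB, hXℓ]
  have u2 : |Au - k * A| ≤ A / 4 := by linarith only [t2, m2, m6, m7, m8, kA, hYℓ]
  have u3 : |Du - k * D| ≤ D / 4 := by linarith only [k3, t1, t2, m1, m2, m3, m4, m5, m6, m7, m8, kD, hXℓ, hYℓ, h3]
  have hkk : |k| ≤ 1 / 4 := by
    have e : -k = α * (Au - k * A) + β * (Bu - k * B) + γ * (Du - k * D) := by
      linear_combination k * hs - hsu
    rw [← abs_neg, e]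
    have w1 := mul_le_mul_of_nonneg_left (abs_le.mp u2).1 hα.le
    have w2 := mul_le_mul_of_nonneg_left (abs_le.mp u2).2 hα.le
    have w3 := mul_le_mul_of_nonneg_left (abs_le.mp u1).1 hβ.le
    have w4 := mul_le_mul_of_nonneg_left (abs_le.mp u1).2 hβ.le
    have w5 := mul_le_mul_of_nonneg_left (abs_le.mp u3).1 hγ.le
    have w6 := mul_le_mul_of_nonneg_left (abs_le.mp u3).2 hγ.le
    rw [abs_le]; constructor <;> linarith only [w1, w2, w3, w4, w5, w6, hs]
  have fin : ∀ A Au : ℝ, 0 < A → |Au - k * A| ≤ A / 4 → 0 ≤ A + τ * Au := by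
    intro A Au hA hu
    have a1 : |Au| ≤ A / 2 := by
      have := abs_add_le (Au - k * A) (k * A)
      rw [sub_add_cancel, abs_mul, abs_of_pos hA] at this
      have : |k| * A ≤ 1 / 4 * A := by gcongr
      linarith only [this, ‹|Au| ≤ _›, hu]
    have a2 : |τ * Au| ≤ 3 / 2 * (A / 2) := by
      rw [abs_mul]; gcongr
    have := (abs_le.mp a2).1
    linarith
  have e : q + τ • u = (α * (A + τ * Au)) • x + (β * (B + τ * Bu)) • y + (γ * (D + τ * Du)) • z := by
    rw [hq, hu]; module
  rw [e]
  apply tri_mem h.hc h.hx h.hy h.hz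
  · exact mul_nonneg hα.le (fin A Au hA u2)
  · exact mul_nonneg hβ.le (fin B Bu hB u1)
  · exact mul_nonneg hγ.le (fin D Du hD u3)
  · linear_combination hs + τ * hsu

lemma surj_box (h : Config Ω x y z α β γ ε c1 c2 c3 l1 l2 l3) {η : ℝ} (hη : 32 * ε ≤ η)
    (hη0 : 0 < η) {X Y : ℝ} 
    (X1 : η ≤ X) (X2 : X ≤ 1 / 16) (Y1 : η ≤ Y) (Y2 : Y ≤ 1 / 16) :
    ∃ q ∈ Ω, (c1 + l1 q) / (c3 + l3 q) = X ∧ (c2 + l2 q) / (c3 + l3 q) = Y := by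
  have hα := h.hα
  have hβ := h.hβ
  have hγ := h.hγ
  have px1 := mul_pos hα (h.p1 x h.hx)
  have px3 := mul_pos hα (h.p3 x h.hx)
  have py2 := mul_pos hβ (h.p2 y h.hy)
  have py3 := mul_pos hβ (h.p3 y h.hy)
  have pz1 := mul_pos hγ (h.p1 z h.hz)
  have pz2 := mul_pos hγ (h.p2 z h.hz)
  have hsol : ∃ A B D : ℝ,
    A * (α * (c1 + l1 x)) + B * (β * (c1 + l1 y)) + D * (γ * (c1 + l1 z)) = X ∧
    A * (α * (c2 + l2 x)) + B * (β * (c2 + l2 y)) + D * (γ * (c2 + l2 z)) = Y ∧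
    A * (α * (c3 + l3 x)) + B * (β * (c3 + l3 y)) + D * (γ * (c3 + l3 z)) = 1 := by
    have e1 := h.e1
    have e2 := h.e2
    have e3 := h.e3
    have s1 := h.s1
    have s2 := h.s2
    have hε := h.hε
    rw [h.s3]
    generalize α * (c1 + l1 x) = x1 at *
    generalize α * (c2 + l2 x) = x2 at *
    generalize α * (c3 + l3 x) = x3 at *
    generalize β * (c1 + l1 y) = y1 at *
    generalize β * (c2 + l2 y) = y2 at *
    generalize β * (c3 + l3 y) = y3 at *
    generalize γ * (c1 + l1 z) = z1 at *
    generalize γ * (c2 + l2 z) = z2 at *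
    have hx3 : x3 ≤ 1 := by linarith
    have hy3 : y3 ≤ 1 := by linarith
    have g1 : |x1 - x3 * z1| ≤ 1 / 256 := by rw [abs_le]; constructor <;> nlinarith
    have g2 : |y2 - y3 * z2| ≤ 1 / 256 := by rw [abs_le]; constructor <;> nlinarith
    have g3 : 1 / 2 ≤ y1 - y3 * z1 := by nlinarith
    have g4 : 1 / 2 ≤ x2 - x3 * z2 := by nlinarith
    set a := x1 - x3 * z1 with ha
    set b := y1 - y3 * z1 with hb
    set c := x2 - x3 * z2 with hc
    set d := y2 - y3 * z2 with hd
    have hΔ : a * d - b * c ≠ 0 := by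
      have m1 : a * d ≤ 1 / 256 * (1 / 256) := by
        calc a * d ≤ |a * d| := le_abs_self _
          _ = |a| * |d| := abs_mul _ _
          _ ≤ _ := by gcongr
      have m2 : 1 / 2 * (1 / 2) ≤ b * c := by gcongr
      intro h0; linarith
    refine ⟨((X - z1) * d - b * (Y - z2)) / (a * d - b * c),
      (a * (Y - z2) - c * (X - z1)) / (a * d - b * c), 
      1 - ((X - z1) * d - b * (Y - z2)) / (a * d - b * c) * x3 -
      (a * (Y - z2) - c * (X - z1)) / (a * d - b * c) * y3, ?_, ?_, by ring⟩
    · have e : ((X - z1) * d - b * (Y - z2)) / (a * d - b * c) * a +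
        (a * (Y - z2) - c * (X - z1)) / (a * d - b * c) * b = X - z1 := by
        rw [div_mul_eq_mul_div, div_mul_eq_mul_div, ← add_div, div_eq_iff hΔ]; ring
      rw [show x1 = a + x3 * z1 by rw [ha]; ring, show y1 = b + y3 * z1 by rw [hb]; ring]
      linear_combination e
    · have e : ((X - z1) * d - b * (Y - z2)) / (a * d - b * c) * c +
        (a * (Y - z2) - c * (X - z1)) / (a * d - b * c) * d = Y - z2 := by
        rw [div_mul_eq_mul_div, div_mul_eq_mul_div, ← add_div, div_eq_iff hΔ]; ring
      rw [show x2 = c + x3 * z2 by rw [hc]; ring, show y2 = d + y3 * z2 by rw [hd]; ring]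
      linear_combination e
  obtain ⟨A, B, D, hX, hY, hZ⟩ := hsol
  obtain ⟨kB, kA, kD⟩ := h.pos_of_box hη hX hY hZ hη0 X1 X2 Y1 Y2
  have hA : 0 < A := by linarith
  have hB : 0 < B := by linarith
  have hD : 0 < D := by linarith
  set t := α * A + β * B + γ * D with ht
  have htp : 0 < t := by positivity
  have hs : α * (A / t) + β * (B / t) + γ * (D / t) = 1 := by
    have : α * (A / t) + β * (B / t) + γ * (D / t) = t / t := by
      conv_rhs => rw [ht]
      rw [← ht]; ring
    rw [this, div_self htp.ne']
  refine ⟨(α * (A / t)) • x + (β * (B / t)) • y + (γ * (D / t)) • z, 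
    tri_mem h.hc h.hx h.hy h.hz (by positivity) (by positivity) (by positivity) hs, ?_, ?_⟩
  · rw [eval_pt hs, eval_pt hs]
    have r1 : A / t * (α * (c1 + l1 x)) + B / t * (β * (c1 + l1 y)) + D / t * (γ * (c1 + l1 z))
      = X / t := by rw [← hX]; ring
    have r3 : A / t * (α * (c3 + l3 x)) + B / t * (β * (c3 + l3 y)) + D / t * (γ * (c3 + l3 z))
      = 1 / t := by rw [← hZ]; ring
    rw [r1, r3]; field_simp
  · rw [eval_pt hs, eval_pt hs]
    have r1 : A / t * (α * (c2 + l2 x)) + B / t * (β * (c2 + l2 y)) + D / t * (γ * (c2 + l2 z))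
      = Y / t := by rw [← hY]; ring
    have r3 : A / t * (α * (c3 + l3 x)) + B / t * (β * (c3 + l3 y)) + D / t * (γ * (c3 + l3 z))
      = 1 / t := by rw [← hZ]; ring
    rw [r1, r3]; field_simp

end Config
end config
end HB

namespace HB

lemma exp_neg_three_le : Real.exp (-3) ≤ 1 / 16 := by
  rw [Real.exp_neg, ← one_div]
  apply one_div_le_one_div_of_le (by norm_num)
  have h := Real.exp_one_gt_d9
  have e : Real.exp 3 = Real.exp 1 ^ 3 := by rw [← Real.exp_nat_mul]; norm_num
  rw [e]
  have : (2.7 : ℝ) ^ 3 ≤ Real.exp 1 ^ 3 := by gcongr; linarith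
  norm_num at this ⊢
  linarith

lemma norm_le_two (v : Euc 2) : ‖v‖ ≤ |v 0| + |v 1| := by
  have h := EuclideanSpace.real_norm_sq_eq v
  rw [Fin.sum_univ_two] at h
  apply abs_le_of_sq_le_sq' _ (by positivity) |>.2
  rw [h, ← sq_abs (v 0), ← sq_abs (v 1)]
  have := abs_nonneg (v 0)
  have := abs_nonneg (v 1)
  nlinarith

/-- the chart -/
noncomputable def Phi (c1 c2 c3 : ℝ) (l1 l2 l3 : Euc 2 →L[ℝ] ℝ) (q : Euc 2) : Euc 2 :=
  !₂[Real.log (c1 + l1 q) - Real.log (c3 + l3 q), Real.log (c2 + l2 q) - Real.log (c3 + l3 q)]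

section
variable {c1 c2 c3 : ℝ} {l1 l2 l3 : Euc 2 →L[ℝ] ℝ}

lemma Phi_contDiffAt {q : Euc 2} (h1 : 0 < c1 + l1 q) (h2 : 0 < c2 + l2 q) (h3 : 0 < c3 + l3 q) :
    ContDiffAt ℝ 1 (Phi c1 c2 c3 l1 l2 l3) q := by
  have key : ∀ (c : ℝ) (l : Euc 2 →L[ℝ] ℝ), 0 < c + l q →
      ContDiffAt ℝ 1 (fun q => Real.log (c + l q)) q := by
    intro c l h
    exact (contDiffAt_const.add l.contDiff.contDiffAt).log h.ne'
  rw [contDiffAt_euclidean]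
  intro i
  fin_cases i
  · simpa [Phi] using (key c1 l1 h1).sub (key c3 l3 h3)
  · simpa [Phi] using (key c2 l2 h2).sub (key c3 l3 h3)

lemma Phi_fderiv {q : Euc 2} (h1 : 0 < c1 + l1 q) (h2 : 0 < c2 + l2 q) (h3 : 0 < c3 + l3 q)
    (u : Euc 2) :
    (fderiv ℝ (Phi c1 c2 c3 l1 l2 l3) q u) 0 = l1 u / (c1 + l1 q) - l3 u / (c3 + l3 q) ∧
    (fderiv ℝ (Phi c1 c2 c3 l1 l2 l3) q u) 1 = l2 u / (c2 + l2 q) - l3 u / (c3 + l3 q) := by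
  have hd : HasStrictFDerivAt (Phi c1 c2 c3 l1 l2 l3) (fderiv ℝ (Phi c1 c2 c3 l1 l2 l3) q) q :=
    (Phi_contDiffAt h1 h2 h3).hasStrictFDerivAt (by simp)
  rw [hasStrictFDerivAt_euclidean] at hd
  have key : ∀ (c : ℝ) (l : Euc 2 →L[ℝ] ℝ), 0 < c + l q →
      HasFDerivAt (fun q => Real.log (c + l q)) ((c + l q)⁻¹ • l) q := by
    intro c l h
    exact (l.hasFDerivAt.const_add c).log h.ne'
  constructor
  · have e := (hd 0).hasFDerivAt.unique (f₁' := (c1 + l1 q)⁻¹ • l1 - (c3 + l3 q)⁻¹ • l3)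
      ((key c1 l1 h1).sub (key c3 l3 h3))
    have := DFunLike.congr_fun e u
    simp at this
    rw [this]; ring
  · have e := (hd 1).hasFDerivAt.unique (f₁' := (c2 + l2 q)⁻¹ • l2 - (c3 + l3 q)⁻¹ • l3)
      ((key c2 l2 h2).sub (key c3 l3 h3))
    have := DFunLike.congr_fun e u
    simp at this
    rw [this]; ring

end

lemma config_bound : ∃ A : ℝ, 0 < A ∧ ∀ (r : ℝ), 0 < r → 
    ∀ (Ω : Set (Euc 2)) (x y z : Euc 2) (α β γ ε c1 c2 c3 : ℝ)
    (l1 l2 l3 : Euc 2 →L[ℝ] ℝ), Config Ω x y z α β γ ε c1 c2 c3 l1 l2 l3 →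
    ε ≤ Real.exp (-(4 * r + 3)) / 32 → lambda1 Ω ≤ A / r ^ 2 := by
  obtain ⟨A, hA, H⟩ := spectral_bound
  refine ⟨A, hA, ?_⟩
  intro r hr Ω x y z α β γ ε c1 c2 c3 l1 l2 l3 h hε
  set η := Real.exp (-(4 * r + 3)) with hηd
  have hη0 : 0 < η := Real.exp_pos _
  have hη : 32 * ε ≤ η := by linarith
  set Φ := Phi c1 c2 c3 l1 l2 l3 with hΦ
  set c : Euc 2 := !₂[-(2 * r + 3), -(2 * r + 3)] with hcd
  -- coordinates in the ball
  have hball : ∀ v ∈ Metric.closedBall c (2 * r), ∀ i, η ≤ Real.exp (v i) ∧ Real.exp (v i) ≤ 1 / 16 := by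
    intro v hv i
    have h1 : |v i - c i| ≤ 2 * r := by
      rw [mem_closedBall_iff_norm] at hv
      have := PiLp.norm_apply_le (v - c) i
      simp only [PiLp.sub_apply, Real.norm_eq_abs] at this
      linarith
    have hci : c i = -(2 * r + 3) := by fin_cases i <;> simp [hcd]
    rw [hci, abs_le] at h1
    constructor
    · rw [hηd]; apply Real.exp_le_exp.mpr; linarith [h1.1]
    · refine le_trans (Real.exp_le_exp.mpr ?_) exp_neg_three_le; linarith [h1.2]
  have hΦ0 : ∀ q ∈ Ω, Real.exp (Φ q 0) = (c1 + l1 q) / (c3 + l3 q) := by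
    intro q hq
    simp [hΦ, Phi, Real.exp_sub, Real.exp_log (h.p1 q hq), Real.exp_log (h.p3 q hq)]
  have hΦ1 : ∀ q ∈ Ω, Real.exp (Φ q 1) = (c2 + l2 q) / (c3 + l3 q) := by
    intro q hq
    simp [hΦ, Phi, Real.exp_sub, Real.exp_log (h.p2 q hq), Real.exp_log (h.p3 q hq)]
  set K : Set (Euc 2) := {q | q ∈ Ω ∧ Φ q ∈ Metric.closedBall c (2 * r)} with hK
  have hcd1 : ∀ q ∈ Ω, ContDiffAt ℝ 1 Φ q := fun q hq =>
    Phi_contDiffAt (h.p1 q hq) (h.p2 q hq) (h.p3 q hq)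
  have hfd : ∀ q ∈ Ω, ∀ u, (fderiv ℝ Φ q u) 0 = l1 u / (c1 + l1 q) - l3 u / (c3 + l3 q) ∧
    (fderiv ℝ Φ q u) 1 = l2 u / (c2 + l2 q) - l3 u / (c3 + l3 q) := fun q hq u =>
    Phi_fderiv (h.p1 q hq) (h.p2 q hq) (h.p3 q hq) u
  -- box property on K
  have hbox : ∀ q ∈ K, ∀ u, ‖fderiv ℝ Φ q u‖ ≤ 1 / 16 → ∀ τ : ℝ, |τ| ≤ 3 / 2 → q + τ • u ∈ Ω := by
    rintro q ⟨hq, hq2⟩ u hu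
    have b0 := hball _ hq2 0
    have b1 := hball _ hq2 1
    rw [hΦ0 q hq] at b0
    rw [hΦ1 q hq] at b1
    have n0 := (PiLp.norm_apply_le (fderiv ℝ Φ q u) 0).trans hu
    have n1 := (PiLp.norm_apply_le (fderiv ℝ Φ q u) 1).trans hu
    rw [(hfd q hq u).1, Real.norm_eq_abs] at n0
    rw [(hfd q hq u).2, Real.norm_eq_abs] at n1
    exact (h.mem_of_box hη hη0 (h.p3 q hq) b0.1 b0.2 b1.1 b1.2).2 u n0 n1
  have hinjd : ∀ q ∈ K, ∀ u, fderiv ℝ Φ q u = 0 → u = 0 := by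
    intro q hq u hu
    by_contra hne
    obtain ⟨a, b, ha, hb0, hab⟩ := line_ends h.hc h.ho h.hb hq.1 hne
    have := hbox q hq (b • u) (by rw [map_smul, hu]; simp) 1 (by norm_num)
    rw [one_smul, hab] at this
    exact lt_irrefl _ this.2
  apply H Ω K Φ c r hr h.ho ?_ (fun q hq => hq.1) (fun q => Iff.rfl) hcd1 ?_ ?_ hinjd ?_ ?_
  · -- compactness
    set K2 : Set (Euc 2) := {q | q ∈ closure Ω ∧ (η * (c3 + l3 q) ≤ c1 + l1 q ∧
      c1 + l1 q ≤ 1 / 16 * (c3 + l3 q)) ∧ (η * (c3 + l3 q) ≤ c2 + l2 q ∧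
      c2 + l2 q ≤ 1 / 16 * (c3 + l3 q))} with hK2
    have hK2cl : IsClosed K2 := by
      have g : ∀ (c : ℝ) (l : Euc 2 →L[ℝ] ℝ), IsClosed {q : Euc 2 | η * (c3 + l3 q) ≤ c + l q} :=
        fun c l => isClosed_le (by fun_prop) (by fun_prop)
      have g' : ∀ (c : ℝ) (l : Euc 2 →L[ℝ] ℝ),
          IsClosed {q : Euc 2 | c + l q ≤ 1 / 16 * (c3 + l3 q)} :=
        fun c l => isClosed_le (by fun_prop) (by fun_prop)
      exact isClosed_closure.inter (((g c1 l1).inter (g' c1 l1)).inter ((g c2 l2).inter (g' c2 l2)))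
    have hK2c : IsCompact K2 :=
      (h.hb.isCompact_closure).of_isClosed_subset hK2cl (fun q hq => hq.1)
    have hK2Ω : K2 ⊆ Ω := by
      rintro q ⟨hq, ⟨a1, a2⟩, ⟨b1, b2⟩⟩
      have hnn : 0 ≤ c3 + l3 q := by
        have hcl : IsClosed {q : Euc 2 | 0 ≤ c3 + l3 q} := isClosed_le (by fun_prop) (by fun_prop)
        exact closure_minimal (fun q hq => (h.p3 q hq).le) hcl hq
      rcases hnn.eq_or_lt with h0 | hpos
      · exfalso
        rw [← h0] at a1 a2 b1 b2
        exact h.not_all_zero q (by linarith) (by linarith) h0.symm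
      · exact (h.mem_of_box hη hη0 hpos (by rwa [le_div_iff₀ hpos]) (by rwa [div_le_iff₀ hpos])
          (by rwa [le_div_iff₀ hpos]) (by rwa [div_le_iff₀ hpos])).1
    have hKe : K = K2 ∩ Φ ⁻¹' Metric.closedBall c (2 * r) := by
      ext q
      constructor
      · rintro ⟨hq, hq2⟩
        have b0 := hball _ hq2 0
        have b1 := hball _ hq2 1
        rw [hΦ0 q hq, le_div_iff₀ (h.p3 q hq), div_le_iff₀ (h.p3 q hq)] at b0
        rw [hΦ1 q hq, le_div_iff₀ (h.p3 q hq), div_le_iff₀ (h.p3 q hq)] at b1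
        exact ⟨⟨subset_closure hq, b0, b1⟩, hq2⟩
      · rintro ⟨hq, hq2⟩
        exact ⟨hK2Ω hq, hq2⟩
    have hcont : ContinuousOn Φ K2 := fun q hq =>
      (hcd1 q (hK2Ω hq)).continuousAt.continuousWithinAt
    rw [hKe]
    exact hK2c.of_isClosed_subset
      (hcont.preimage_isClosed_of_isClosed hK2cl Metric.isClosed_closedBall) inter_subset_left
  · -- injectivity
    intro q hq q' hq' e
    have e0 := hΦ0 q hq.1
    have e1 := hΦ1 q hq.1
    rw [e, hΦ0 q' hq'.1] at e0
    rw [e, hΦ1 q' hq'.1] at e1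
    have P1 := h.p1 q hq.1
    have P2 := h.p2 q hq.1
    have P3 := h.p3 q hq.1
    have P3' := h.p3 q' hq'.1
    rw [div_eq_div_iff P3'.ne' P3.ne'] at e0 e1
    have hw : fderiv ℝ Φ q (q' - q) = 0 := by
      ext i
      fin_cases i
      · refine ((hfd q hq.1 _).1).trans ?_
        simp only [map_sub, PiLp.zero_apply]
        rw [sub_eq_zero, div_eq_div_iff P1.ne' P3.ne']
        linarith
      · refine ((hfd q hq.1 _).2).trans ?_
        simp only [map_sub, PiLp.zero_apply]
        rw [sub_eq_zero, div_eq_div_iff P2.ne' P3.ne']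
        linarith
    exact (sub_eq_zero.mp (hinjd q hq _ hw)).symm
  · -- surjectivity
    intro v hv
    have hv2 : v ∈ Metric.closedBall c (2 * r) :=
      Metric.closedBall_subset_closedBall (by linarith) hv
    have b0 := hball v hv2 0
    have b1 := hball v hv2 1
    obtain ⟨q, hq, k1, k2⟩ := h.surj_box hη hη0 b0.1 b0.2 b1.1 b1.2
    have e : Φ q = v := by
      ext i
      fin_cases i
      · exact Real.exp_injective ((hΦ0 q hq).trans k1)
      · exact Real.exp_injective ((hΦ1 q hq).trans k2)
    exact ⟨q, ⟨hq, by rw [e]; exact hv2⟩, e⟩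
  · intro q hq u
    refine (norm_le_two _).trans ?_
    rw [(hfd q hq.1 u).1, (hfd q hq.1 u).2]
    have := le_fNorm h.hc h.ho h.hb u hq.1 h.p1 h.p3
    have := le_fNorm h.hc h.ho h.hb u hq.1 h.p2 h.p3
    linarith
  · intro q hq u hu
    have := hbox q hq u hu.le
    exact fNorm_lt_one h.hc h.ho h.hb hq.1 (this _ (by rw [abs_of_pos] <;> norm_num))
      (this _ (by rw [abs_neg, abs_of_pos] <;> norm_num))

end HB

namespace HB

section far
variable {n : ℕ} {C : Set (Euc n)}

lemma normalize {p : Euc n} (hp : p ∈ C) {c : ℝ} {l : Euc n →L[ℝ] ℝ}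
    (hL : ∀ q ∈ C, 0 < c + l q) :
    ∃ (c' : ℝ) (l' : Euc n →L[ℝ] ℝ), (∀ q, c' + l' q = (c + l q) / (c + l p)) ∧
      (∀ q ∈ C, 0 < c' + l' q) ∧ c' + l' p = 1 := by
  have hpp := hL p hp
  have e : ∀ q, (c + l p)⁻¹ * c + ((c + l p)⁻¹ • l) q = (c + l q) / (c + l p) := by
    intro q
    simp only [smul_apply, smul_eq_mul]
    rw [div_eq_mul_inv]; ring
  refine ⟨(c + l p)⁻¹ * c, (c + l p)⁻¹ • l, e, fun q hq => ?_, ?_⟩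
  · rw [e]; exact div_pos (hL q hq) hpp
  · rw [e]; exact div_self hpp.ne'

lemma far (hc : Convex ℝ C) (ho : IsOpen C) (hb : Bornology.IsBounded C)
    {p x z : Euc n} (hp : p ∈ C) (hx : x ∈ C) (hz : z ∈ C) {α γ : ℝ} (hα : 0 < α) (hγ : 0 < γ)
    (k1 : ∀ (c : ℝ) (l : Euc n →L[ℝ] ℝ), (∀ q ∈ C, 0 < c + l q) → α * (c + l x) ≤ c + l p)
    (k2 : ∀ (c : ℝ) (l : Euc n →L[ℝ] ℝ), (∀ q ∈ C, 0 < c + l q) → γ * (c + l z) ≤ c + l p)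
    {R : ℝ} (hfar : ∀ m ∈ segment ℝ x z, R < hDist C p m) :
    ∃ (c : ℝ) (l : Euc n →L[ℝ] ℝ), (∀ q ∈ C, 0 < c + l q) ∧ c + l p = 1 ∧
      α * (c + l x) + γ * (c + l z) ≤ 2 * Real.exp (-(2 * R)) := by
  have hs : 0 < α + γ := by linarith
  set m : Euc n := (α / (α + γ)) • x + (γ / (α + γ)) • z with hm
  have hmseg : m ∈ segment ℝ x z :=
    ⟨α / (α + γ), γ / (α + γ), by positivity, by positivity, by field_simp, rfl⟩
  have hmC : m ∈ C := hc.segment_subset hx hz hmseg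
  have ev : ∀ (c : ℝ) (l : Euc n →L[ℝ] ℝ), (α + γ) * (c + l m) = α * (c + l x) + γ * (c + l z) := by
    intro c l
    rw [hm]
    simp only [map_add, map_smul, smul_eq_mul]
    field_simp; ring
  obtain ⟨c, c', l, l', hl, hl', e⟩ := functional_eq hc ho hb hp hmC
  have hR := hfar m hmseg
  have b1 := k1 c' l' hl'
  have b2 := k2 c' l' hl'
  have e' := ev c' l'
  have hp1 := hl p hp
  have hp2 := hl' p hp
  have hm1 := hl m hmC
  have step : Real.exp (2 * R) * ((α + γ) * (c + l m)) ≤ 2 * (c + l p) := by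
    have s1 : Real.exp (2 * R) ≤ Real.exp (2 * hDist C p m) := Real.exp_le_exp.mpr (by linarith)
    have s2 : Real.exp (2 * R) * ((α + γ) * (c + l m)) ≤
      Real.exp (2 * hDist C p m) * ((α + γ) * (c + l m)) := by gcongr
    refine s2.trans ?_
    rw [← mul_le_mul_iff_left₀ hp2]
    calc Real.exp (2 * hDist C p m) * ((α + γ) * (c + l m)) * (c' + l' p)
        = (α + γ) * (Real.exp (2 * hDist C p m) * ((c + l m) * (c' + l' p))) := by ring
      _ = (c + l p) * ((α + γ) * (c' + l' m)) := by rw [← e]; ring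
      _ ≤ (c + l p) * (2 * (c' + l' p)) :=
        mul_le_mul_of_nonneg_left (by linarith) hp1.le
      _ = _ := by ring
  obtain ⟨d, k, he, hpos, h1⟩ := normalize hp hl
  refine ⟨d, k, hpos, h1, ?_⟩
  rw [← ev d k, he, Real.exp_neg, ← div_eq_mul_inv, le_div_iff₀ (Real.exp_pos _),
    ← mul_div_assoc, div_mul_eq_mul_div, div_le_iff₀ hp1]
  linarith

lemma back_end {p v : Euc n} {a κ : ℝ} (ha : a < 0) (hκ : 0 < κ)
    (h : ∀ t : ℝ, p + t • v ∈ C ↔ a < t ∧ t < κ) (c : ℝ) (l : Euc n →L[ℝ] ℝ)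
    (hl : ∀ q ∈ C, 0 < c + l q) : 0 ≤ c + l p + κ * l v := by
  have hcl : ∀ t ∈ closure (Ioo a κ), 0 ≤ (c + l p) + t * l v := by
    intro t ht
    have hclosed : IsClosed {t : ℝ | 0 ≤ (c + l p) + t * l v} :=
      isClosed_le continuous_const (by fun_prop)
    refine closure_minimal (fun t ht => ?_) hclosed ht
    have := hl _ ((h t).mpr ht)
    simp only [map_add, map_smul, smul_eq_mul] at this
    simp only [mem_ofPred_eq]; linarith
  rw [closure_Ioo (by linarith)] at hcl
  exact hcl κ ⟨by linarith, le_rfl⟩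

end far

lemma planar (lam : ℝ) (hlam : 0 < lam) : ∃ R : ℝ, 0 ≤ R ∧ ∀ Ω : Set (Euc 2), Convex ℝ Ω →
    IsOpen Ω → Bornology.IsBounded Ω → lambda1 Ω ≥ lam →
    ∀ x ∈ Ω, ∀ y ∈ Ω, ∀ z ∈ Ω, (∀ w : Euc 2, ∃ a b : ℝ, w = a • (x - z) + b • (y - z)) →
    ∀ p ∈ segment ℝ x y, ∃ m, (m ∈ segment ℝ x z ∨ m ∈ segment ℝ y z) ∧ hDist Ω p m ≤ R := by
  obtain ⟨A, hA, H⟩ := config_bound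
  set r := Real.sqrt (2 * A / lam) with hr
  have hq : 0 < 2 * A / lam := by positivity
  have hr0 : 0 < r := Real.sqrt_pos.mpr hq
  have hrr : A / r ^ 2 < lam := by
    rw [hr, Real.sq_sqrt hq.le, div_div_eq_mul_div, div_lt_iff₀ (by positivity)]
    nlinarith [mul_pos hA hlam]
  set ε0 := min (Real.exp (-(4 * r + 3)) / 32) (1 / 256) with hε0
  have hε0p : 0 < ε0 := lt_min (by positivity) (by norm_num)
  set R := |Real.log (ε0 / 2)| with hR
  have hR0 : 0 ≤ R := abs_nonneg _
  have hRε : 2 * Real.exp (-(2 * R)) ≤ ε0 := by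
    have h1 : -(2 * R) ≤ Real.log (ε0 / 2) := by
      have := neg_abs_le (Real.log (ε0 / 2)); linarith
    have := Real.exp_le_exp.mpr h1
    rw [Real.exp_log (by positivity)] at this
    linarith
  refine ⟨R, hR0, ?_⟩
  intro Ω hc ho hb hlb x hx y hy z hz hspan p hp
  by_contra! hcon
  have hpΩ : p ∈ Ω := hc.segment_subset hx hy hp
  have f1 : ∀ m ∈ segment ℝ x z, R < hDist Ω p m := fun m hm => hcon m (Or.inl hm)
  have f2 : ∀ m ∈ segment ℝ y z, R < hDist Ω p m := fun m hm => hcon m (Or.inr hm)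
  have nseg : ∀ m, hDist Ω p m > R → p ≠ m := by
    rintro m hm rfl
    rw [hDist_self] at hm; linarith
  have hpz : p ≠ z := nseg z (f1 z (right_mem_segment ℝ x z))
  have hpx : p ≠ x := nseg x (f1 x (left_mem_segment ℝ x z))
  have hpy : p ≠ y := nseg y (f2 y (left_mem_segment ℝ y z))
  obtain ⟨α, β, hα, hβ, hαβ, hpe⟩ := hp
  have hα' : 0 < α := by
    rcases hα.eq_or_lt with h | h
    · exfalso; apply hpy; rw [← hpe, ← h, show β = 1 by linarith]; simp
    · exact h
  have hβ' : 0 < β := by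
    rcases hβ.eq_or_lt with h | h
    · exfalso; apply hpx; rw [← hpe, ← h, show α = 1 by linarith]; simp
    · exact h
  obtain ⟨a, κ, ha, hκ, hline⟩ := line_ends hc ho hb hpΩ (v := p - z) (sub_ne_zero.mpr hpz)
  have evp : ∀ (c : ℝ) (l : Euc 2 →L[ℝ] ℝ), c + l p = α * (c + l x) + β * (c + l y) := by
    intro c l
    rw [← hpe]
    simp only [map_add, map_smul, smul_eq_mul]
    linear_combination (-c) * hαβ
  set γ := κ / (1 + κ) with hγd
  have hγ : 0 < γ := by positivity
  have hγκ : γ * (1 + κ) = κ := by rw [hγd]; field_simp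
  have kx : ∀ (c : ℝ) (l : Euc 2 →L[ℝ] ℝ), (∀ q ∈ Ω, 0 < c + l q) → α * (c + l x) ≤ c + l p := by
    intro c l h
    have := mul_pos hβ' (h y hy)
    rw [evp]; linarith
  have ky : ∀ (c : ℝ) (l : Euc 2 →L[ℝ] ℝ), (∀ q ∈ Ω, 0 < c + l q) → β * (c + l y) ≤ c + l p := by
    intro c l h
    have := mul_pos hα' (h x hx)
    rw [evp]; linarith
  have kz : ∀ (c : ℝ) (l : Euc 2 →L[ℝ] ℝ), (∀ q ∈ Ω, 0 < c + l q) → γ * (c + l z) ≤ c + l p := by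
    intro c l h
    have := back_end ha hκ hline c l h
    rw [map_sub] at this
    rw [hγd, div_mul_eq_mul_div, div_le_iff₀ (by linarith)]
    linarith
  obtain ⟨c1, l1, P1, E1, S1⟩ := far hc ho hb hpΩ hx hz hα' hγ kx kz f1
  obtain ⟨c2, l2, P2, E2, S2⟩ := far hc ho hb hpΩ hy hz hβ' hγ ky kz f2
  obtain ⟨c, l, hl, hl0⟩ := exists_support hc ho (b := p + κ • (p - z)) (by rw [hline]; simp)
  obtain ⟨c3, l3, he, P3, E3⟩ := normalize hpΩ hl
  have S3 : γ * (c3 + l3 z) = 1 := by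
    have hpp := hl p hpΩ
    rw [he, hγd, div_mul_div_comm, div_eq_one_iff_eq (by positivity)]
    simp only [map_add, map_smul, map_sub, smul_eq_mul] at hl0
    linarith
  rw [evp] at E1 E2 E3
  have cfg : Config Ω x y z α β γ (2 * Real.exp (-(2 * R))) c1 c2 c3 l1 l2 l3 :=
    { hc := hc, ho := ho, hb := hb, hx := hx, hy := hy, hz := hz, hα := hα', hβ := hβ', hγ := hγ,
      hspan := hspan, p1 := P1, p2 := P2, p3 := P3, e1 := E1, e2 := E2, e3 := E3,
      s1 := S1, s2 := S2, s3 := S3, hε := hRε.trans (min_le_right _ _) }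
  have := H r hr0 Ω x y z α β γ _ c1 c2 c3 l1 l2 l3 cfg (hRε.trans (min_le_left _ _))
  linarith

end HB

namespace HB

variable {n : ℕ} {C : Set (Euc n)}

lemma collin {x y z p : Euc n} {k : ℝ} (hk : x - z = k • (y - z)) (hp : p ∈ segment ℝ x y) :
    p ∈ segment ℝ x z ∨ p ∈ segment ℝ y z := by
  obtain ⟨α, β, hα, hβ, hαβ, rfl⟩ := hp
  have hx : x = z + k • (y - z) := by rw [← hk]; abel
  set τ := α * k + β with hτ
  have hpe : α • x + β • y = z + τ • (y - z) := by
    rw [hx, hτ, show α = 1 - β by linarith]; module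
  have inx : k ≠ 0 → 0 ≤ τ / k → τ / k ≤ 1 → α • x + β • y ∈ segment ℝ x z := by
    intro hk0 h0 h1
    refine ⟨τ / k, 1 - τ / k, h0, by linarith, by ring, ?_⟩
    rw [hpe, hx]
    have : τ = (τ / k) * k := by field_simp
    conv_rhs => rw [this]
    module
  rcases lt_or_ge τ 0 with h | h
  · left
    have hk0 : k < 0 := by
      by_contra! hge
      have := mul_nonneg hα hge
      linarith
    have hkτ : k ≤ τ := by
      have e : k - τ = β * (k - 1) := by rw [hτ, show α = 1 - β by linarith]; ring
      have := mul_nonpos_of_nonneg_of_nonpos hβ (by linarith : k - 1 ≤ 0)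
      linarith
    exact inx hk0.ne (div_nonneg_of_nonpos h.le hk0.le) ((div_le_one_of_neg hk0).mpr hkτ)
  · rcases le_or_gt τ 1 with h1 | h1
    · right
      refine ⟨τ, 1 - τ, h, by linarith, by ring, ?_⟩
      rw [hpe]; module
    · left
      have hk1 : 1 < k := by
        by_contra! hle
        have := mul_le_mul_of_nonneg_left hle hα
        linarith
      have hkτ : τ ≤ k := by
        have e : k - τ = β * (k - 1) := by rw [hτ, show α = 1 - β by linarith]; ring
        have := mul_nonneg hβ (by linarith : 0 ≤ k - 1)
        linarith
      have hk0 : 0 < k := by linarith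
      exact inx hk0.ne' (by positivity) ((div_le_one hk0).mpr hkτ)

lemma hDist_preimage (φ : Euc 2 →ᵃⁱ[ℝ] Euc n) (a b : Euc 2) :
    hDist C (φ a) (φ b) = hDist (φ ⁻¹' C) a b := by
  have hl : lineParams C (φ a) (φ b - φ a) = lineParams (φ ⁻¹' C) a (b - a) := by
    ext t
    simp only [lineParams, mem_ofPred_eq, mem_preimage]
    have : φ (a + t • (b - a)) = φ a + t • (φ b - φ a) := by
      have h1 := φ.map_vadd a (t • (b - a))
      have h2 := φ.linearIsometry.map_smul t (b - a)
      have h3 := φ.toAffineMap.linearMap_vsub b a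
      simp only [vadd_eq_add, vsub_eq_sub] at h1 h3
      rw [add_comm, h1, h2, add_comm]
      congr 2
    rw [this]
  unfold hDist
  rw [hl]
  simp only [φ.injective.eq_iff]

lemma reduction {R lam : ℝ} (hR0 : 0 ≤ R) (hR : ∀ Ω : Set (Euc 2), Convex ℝ Ω →
    IsOpen Ω → Bornology.IsBounded Ω → lambda1 Ω ≥ lam →
    ∀ x ∈ Ω, ∀ y ∈ Ω, ∀ z ∈ Ω, (∀ w : Euc 2, ∃ a b : ℝ, w = a • (x - z) + b • (y - z)) →
    ∀ p ∈ segment ℝ x y, ∃ m, (m ∈ segment ℝ x z ∨ m ∈ segment ℝ y z) ∧ hDist Ω p m ≤ R)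
    (hc : Convex ℝ C) (ho : IsOpen C) (hb : Bornology.IsBounded C)
    (hlam : ∀ φ : Euc 2 →ᵃⁱ[ℝ] Euc n, (φ ⁻¹' C).Nonempty → lambda1 (φ ⁻¹' C) ≥ lam) :
    ∀ x ∈ C, ∀ y ∈ C, ∀ z ∈ C, ∀ p ∈ segment ℝ x y,
      ∃ m, (m ∈ segment ℝ x z ∨ m ∈ segment ℝ y z) ∧ hDist C p m ≤ R := by
  intro x hx y hy z hz p hp
  by_cases hli : LinearIndependent ℝ ![x - z, y - z]
  · set S := Submodule.span ℝ (range ![x - z, y - z]) with hS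
    have hfr : Module.finrank ℝ S = 2 := by
      rw [hS, finrank_span_eq_card hli]; simp
    let B : OrthonormalBasis (Fin 2) ℝ S := (stdOrthonormalBasis ℝ S).reindex (finCongr hfr)
    let L : Euc 2 →ₗᵢ[ℝ] Euc n := S.subtypeₗᵢ.comp B.repr.symm.toLinearIsometry
    let φ : Euc 2 →ᵃⁱ[ℝ] Euc n :=
      (AffineIsometryEquiv.vaddConst ℝ z).toAffineIsometry.comp L.toAffineIsometry
    have hφ : ∀ q, φ q = L q + z := fun q => rfl
    have hLS : ∀ q, L q ∈ S := fun q => (B.repr.symm q).2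
    have hsurj : ∀ u ∈ S, ∃ q, L q = u := fun u hu => ⟨B.repr ⟨u, hu⟩, by
      change ((B.repr.symm (B.repr ⟨u, hu⟩) : S) : Euc n) = u
      rw [LinearIsometryEquiv.symm_apply_apply]⟩
    obtain ⟨x', hx'⟩ := hsurj (x - z) (Submodule.subset_span ⟨0, rfl⟩)
    obtain ⟨y', hy'⟩ := hsurj (y - z) (Submodule.subset_span ⟨1, rfl⟩)
    have ex : φ x' = x := by rw [hφ, hx']; abel
    have ey : φ y' = y := by rw [hφ, hy']; abel
    have ez : φ 0 = z := by rw [hφ, map_zero, zero_add]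
    have haff : ∀ (s t : ℝ) (a b : Euc 2), s + t = 1 →
        φ (s • a + t • b) = s • φ a + t • φ b := by
      intro s t a b hst
      simp only [hφ, map_add, map_smul]
      rw [show s = 1 - t by linarith]; module
    have hseg : ∀ a b m, m ∈ segment ℝ a b → φ m ∈ segment ℝ (φ a) (φ b) := by
      rintro a b _ ⟨s, t, hs, ht, hst, rfl⟩
      exact ⟨s, t, hs, ht, hst, (haff s t a b hst).symm⟩
    have Dc : Convex ℝ (φ ⁻¹' C) := by
      intro a ha b hb s t hs ht hst
      change φ _ ∈ C
      rw [haff s t a b hst]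
      exact hc ha hb hs ht hst
    have Do : IsOpen (φ ⁻¹' C) := ho.preimage φ.continuous
    have Db : Bornology.IsBounded (φ ⁻¹' C) := φ.antilipschitz.isBounded_preimage hb
    have hx1 : x' ∈ φ ⁻¹' C := by change φ x' ∈ C; rwa [ex]
    have hy1 : y' ∈ φ ⁻¹' C := by change φ y' ∈ C; rwa [ey]
    have hz1 : (0 : Euc 2) ∈ φ ⁻¹' C := by change φ 0 ∈ C; rwa [ez]
    obtain ⟨s, t, hs, ht, hst, hpe⟩ := hp
    have ep : φ (s • x' + t • y') = p := by rw [haff s t _ _ hst, ex, ey, hpe]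
    obtain ⟨m, hm, hd⟩ := hR (φ ⁻¹' C) Dc Do Db (hlam φ ⟨0, hz1⟩) x' hx1 y' hy1 0 hz1 (by
      intro w
      have := hLS w
      rw [hS, Matrix.range_cons, Matrix.range_cons, Matrix.range_empty, union_empty,
        singleton_union, Submodule.mem_span_pair] at this
      obtain ⟨a, b, hab⟩ := this
      refine ⟨a, b, L.injective ?_⟩
      rw [← hab]
      simp [hx', hy']) (s • x' + t • y') ⟨s, t, hs, ht, hst, rfl⟩
    refine ⟨φ m, ?_, ?_⟩
    · rcases hm with hm | hm
      · left; have := hseg _ _ _ hm; rwa [ex, ez] at this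
      · right; have := hseg _ _ _ hm; rwa [ey, ez] at this
    · rw [← ep, hDist_preimage]; exact hd
  · refine ⟨p, ?_, by rw [hDist_self]; exact hR0⟩
    rw [LinearIndependent.pair_iff] at hli
    push Not at hli
    obtain ⟨s, t, hst, hne⟩ := hli
    by_cases hs : s = 0
    · have ht := hne hs
      rw [hs, zero_smul, zero_add] at hst
      have hyz : y - z = 0 := (smul_eq_zero.mp hst).resolve_left ht
      rw [or_comm]
      refine collin (k := 0) ?_ ?_
      · rw [hyz, zero_smul]
      · rw [segment_symm]; exact hp
    · refine collin (k := -(t / s)) ?_ hp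
      have : s • (x - z) = s • (-(t / s)) • (y - z) := by
        rw [smul_smul, mul_neg, mul_div_cancel₀ _ hs, neg_smul]
        exact eq_neg_of_add_eq_zero_left hst
      exact smul_right_injective _ hs this

end HB

/-- if all planar sections of the bounded open convex set `C ⊆ ℝⁿ` have
`λ₁ ≥ λ` for some `λ > 0`, then `(C, d_C)` is `δ`-hyperbolic, where `δ = δ(λ) ≥ 0`
depends only on `λ` (and the dimension). -/
theorem stmt7 {n : ℕ} (lam : ℝ) (hlam : 0 < lam) :
    ∃ δ : ℝ, 0 ≤ δ ∧ ∀ C : Set (Euc n), Convex ℝ C → IsOpen C →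
      Bornology.IsBounded C → C.Nonempty →
      (∀ φ : Euc 2 →ᵃⁱ[ℝ] Euc n, (φ ⁻¹' C).Nonempty → lambda1 (φ ⁻¹' C) ≥ lam) →
      IsDeltaHyp C δ := by
  obtain ⟨R, hR0, hR⟩ := HB.planar lam hlam
  refine ⟨3 * R + 4, by linarith, ?_⟩
  intro C hc ho hb _ hφ
  exact HB.slim_imp_hyp hc ho hb (HB.reduction hR0 hR hc ho hb hφ)
end
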